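/- Let n be a positive integer and b coprime to n. Let Ω(X) be the set of squarefree positive integers x ≤ X all of whose prime factors are congruent to b modulo n. Then there is a constant c > 0 such that |Ω(X)| = (c + o(1)) · X / (log X)^{1 − 1/φ(n)} as X → ∞. -/

import Mathlib

open Filter


section Part1
open Filter Topology MeasureTheory Set

/-- Fejer-type kernel. -/
noncomputable def fejK (u : ℝ) : ℝ := ∫ y in (-1:ℝ)..1, (1 - |y|) * Real.cos (y * u)

lemma fejK_half (u : ℝ) : fejK u = 2 * ∫ y in (0:ℝ)..1, (1 - y) * Real.cos (y * u) := by
  have hc : Continuous (fun y : ℝ => (1 - |y|) * Real.cos (y * u)) := by fun_prop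
  have e1 : ∫ y in (0:ℝ)..1, (1 - |y|) * Real.cos (y * u) = ∫ y in (0:ℝ)..1, (1 - y) * Real.cos (y * u) := by
    apply intervalIntegral.integral_congr
    intro y hy
    rw [uIcc_of_le (by norm_num)] at hy
    simp [abs_of_nonneg hy.1]
  have e2 : ∫ y in (-1:ℝ)..0, (1 - |y|) * Real.cos (y * u) = ∫ y in (0:ℝ)..1, (1 - |y|) * Real.cos (y * u) := by
    have := intervalIntegral.integral_comp_neg (a := 0) (b := 1) (fun y : ℝ => (1 - |y|) * Real.cos (y * u))
    simp only [abs_neg, neg_mul, Real.cos_neg, neg_zero] at this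
    exact this.symm
  rw [fejK, ← intervalIntegral.integral_add_adjacent_intervals (b := 0) (hc.intervalIntegrable _ _) (hc.intervalIntegrable _ _), e2, e1]
  ring

lemma fejK_eq {u : ℝ} (hu : u ≠ 0) : fejK u = 2 * (1 - Real.cos u) / u ^ 2 := by
  rw [fejK_half]
  have : ∀ y ∈ uIcc (0:ℝ) 1, HasDerivAt (fun y => (1 - y) * Real.sin (y * u) / u - Real.cos (y * u) / u ^ 2)
      ((1 - y) * Real.cos (y * u)) y := by
    intro y _
    have h1 : HasDerivAt (fun y : ℝ => y * u) u y := by simpa using (hasDerivAt_id y).mul_const u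
    have h2 : HasDerivAt (fun y : ℝ => 1 - y) (-1) y := by simpa using (hasDerivAt_id y).const_sub 1
    have h3 := ((h2.mul h1.sin).div_const u).sub (h1.cos.div_const (u^2))
    refine HasDerivAt.congr_deriv h3 ?_
    field_simp
    ring
  rw [intervalIntegral.integral_eq_sub_of_hasDerivAt this ((by fun_prop : Continuous _).intervalIntegrable _ _)]
  simp
  field_simp
  ring

lemma fejK_zero : fejK 0 = 1 := by
  rw [fejK_half]
  simp only [mul_zero, Real.cos_zero, mul_one]
  rw [intervalIntegral.integral_sub (by simp) (by simp), integral_id]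
  norm_num

lemma fejK_nonneg (u : ℝ) : 0 ≤ fejK u := by
  by_cases hu : u = 0
  · simp [hu, fejK_zero]
  · rw [fejK_eq hu]
    have := Real.cos_le_one u
    have : 0 ≤ 1 - Real.cos u := by linarith
    positivity

lemma fejK_le_two (u : ℝ) : fejK u ≤ 2 := by
  have : ‖fejK u‖ ≤ 1 * |(1:ℝ) - (-1)| := by
    apply intervalIntegral.norm_integral_le_of_norm_le_const
    intro y hy
    rw [uIoc_of_le (by norm_num)] at hy
    have h1 : |y| ≤ 1 := abs_le.2 ⟨hy.1.le, hy.2⟩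
    rw [norm_mul, Real.norm_eq_abs, Real.norm_eq_abs, abs_of_nonneg (by linarith : 0 ≤ 1 - |y|)]
    have := Real.abs_cos_le_one (y * u)
    have := abs_nonneg y
    nlinarith [abs_nonneg (Real.cos (y*u))]
  rw [Real.norm_eq_abs] at this
  norm_num at this
  linarith [le_abs_self (fejK u)]

lemma fejK_le (u : ℝ) : fejK u ≤ 6 * (1 + u ^ 2)⁻¹ := by
  rw [← div_eq_mul_inv, le_div_iff₀ (by positivity)]
  have h1 := fejK_le_two u
  by_cases hu : u = 0
  · subst hu; simp; linarith
  have h2 : fejK u * u ^ 2 = 2 * (1 - Real.cos u) := by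
    rw [fejK_eq hu]; field_simp
  have := Real.neg_one_le_cos u
  nlinarith

lemma fejK_continuous : Continuous fejK := by
  unfold fejK
  apply intervalIntegral.continuous_parametric_intervalIntegral_of_continuous'
  fun_prop

lemma fejK_integrable : Integrable fejK := by
  apply (integrable_inv_one_add_sq.const_mul 6).mono' fejK_continuous.aestronglyMeasurable
  filter_upwards with u
  rw [Real.norm_eq_abs, abs_of_nonneg (fejK_nonneg u)]
  exact fejK_le u

lemma fejK_integral_pos : 0 < ∫ u, fejK u := by
  rw [integral_pos_iff_support_of_nonneg fejK_nonneg fejK_integrable]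
  exact (fejK_continuous.isOpen_support).measure_pos volume ⟨0, by simp [fejK_zero]⟩

lemma fejK_complex (u : ℝ) : (fejK u : ℂ) =
    ∫ y in (-1:ℝ)..1, ((1 - |y| : ℝ) : ℂ) * Complex.exp (Complex.I * y * u) := by
  have hre : ∀ y : ℝ, ((1 - |y| : ℝ) : ℂ) * Complex.exp (Complex.I * y * u) =
      (((1 - |y|) * Real.cos (y * u) : ℝ) : ℂ) + (((1 - |y|) * Real.sin (y * u) : ℝ) : ℂ) * Complex.I := by
    intro y
    have : Complex.I * y * u = ((y * u : ℝ) : ℂ) * Complex.I := by push_cast; ring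
    rw [this, Complex.exp_mul_I, ← Complex.ofReal_cos, ← Complex.ofReal_sin]
    push_cast; ring
  simp_rw [hre]
  rw [intervalIntegral.integral_add ((by fun_prop : Continuous _).intervalIntegrable _ _) ((by fun_prop : Continuous _).intervalIntegrable _ _),
    intervalIntegral.integral_mul_const, intervalIntegral.integral_ofReal, intervalIntegral.integral_ofReal]
  have : ∫ y in (-1:ℝ)..1, (1 - |y|) * Real.sin (y * u) = 0 := by
    have := intervalIntegral.integral_comp_neg (a := -1) (b := 1) (fun y : ℝ => (1 - |y|) * Real.sin (y * u))
    simp only [abs_neg, neg_mul, Real.sin_neg, mul_neg, neg_neg, intervalIntegral.integral_neg] at this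
    linarith
  rw [this, fejK]
  simp

lemma tauber_eps (a : ℝ → ℝ) (D : ℝ) (ha : Measurable a) (hD : ∀ t, 0 < t → |a t| ≤ D)
    (G : ℂ → ℂ) (hG : ∀ z : ℂ, 0 < z.re → ∫ t in Ioi (0:ℝ), (a t : ℂ) * Complex.exp (-z * t) = G z)
    (T ε : ℝ) (hε : 0 < ε) :
    ∫ t in Ioi (0:ℝ), ((a t * Real.exp (-ε * t) * fejK (T - t) : ℝ) : ℂ) =
      ∫ y in (-1:ℝ)..1, ((1 - |y| : ℝ) : ℂ) * Complex.exp (Complex.I * y * T) * G (ε + Complex.I * y) := by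
  have hexp : IntegrableOn (fun t => Real.exp (-ε * t)) (Ioi 0) := exp_neg_integrableOn_Ioi 0 hε
  calc _ = ∫ t in Ioi (0:ℝ), ∫ y in Ioc (-1:ℝ) 1, ((a t * Real.exp (-ε * t) : ℝ) : ℂ) * (((1 - |y| : ℝ) : ℂ) * Complex.exp (Complex.I * y * ((T - t : ℝ) : ℂ))) := by
        congr 1; ext t
        rw [Complex.ofReal_mul, fejK_complex, intervalIntegral.integral_of_le (by norm_num), ← integral_const_mul]
    _ = ∫ y in Ioc (-1:ℝ) 1, ∫ t in Ioi (0:ℝ), ((a t * Real.exp (-ε * t) : ℝ) : ℂ) * (((1 - |y| : ℝ) : ℂ) * Complex.exp (Complex.I * y * ((T - t : ℝ) : ℂ))) := by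
        apply integral_integral_swap
        have h1 : Integrable (fun p : ℝ × ℝ => (D * Real.exp (-ε * p.1)) * (1:ℝ)) ((volume.restrict (Ioi 0)).prod (volume.restrict (Ioc (-1:ℝ) 1))) :=
          Integrable.mul_prod (hexp.const_mul D) (integrable_const (1:ℝ))
        apply h1.mono'
        · apply Measurable.aestronglyMeasurable
          unfold Function.uncurry
          fun_prop
        · rw [Measure.prod_restrict]
          filter_upwards [ae_restrict_mem (measurableSet_Ioi.prod measurableSet_Ioc)] with p hp
          obtain ⟨hp1, hp2⟩ := hp
          have h2 : |p.2| ≤ 1 := abs_le.2 ⟨hp2.1.le, hp2.2⟩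
          have h3 : Complex.I * p.2 * ((T - p.1 : ℝ) : ℂ) = ((p.2 * (T - p.1) : ℝ) : ℂ) * Complex.I := by push_cast; ring
          simp only [Function.uncurry]
          rw [norm_mul, norm_mul, h3, Complex.norm_exp_ofReal_mul_I, Complex.norm_real, Complex.norm_real, Real.norm_eq_abs, Real.norm_eq_abs, abs_mul, Real.abs_exp, mul_one]
          gcongr
          · exact mul_nonneg ((abs_nonneg _).trans (hD _ hp1)) (Real.exp_pos _).le
          · exact hD _ hp1
          · rw [abs_of_nonneg (by linarith)]; linarith [abs_nonneg p.2]
    _ = _ := by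
        rw [intervalIntegral.integral_of_le (by norm_num)]
        congr 1; ext y
        rw [← hG _ (by simpa using hε), ← integral_const_mul]
        congr 1; ext t
        have : Complex.exp (Complex.I * y * ((T - t : ℝ) : ℂ)) * Complex.exp ((-ε * t : ℝ) : ℂ) = Complex.exp (Complex.I * y * T) * Complex.exp (-(ε + Complex.I * y) * t) := by
          rw [← Complex.exp_add, ← Complex.exp_add]; congr 1; push_cast; ring
        rw [Complex.ofReal_mul, Complex.ofReal_exp]
        linear_combination (a t : ℂ) * ((1 - |y| : ℝ) : ℂ) * this

lemma tauber_smooth (a : ℝ → ℝ) (D : ℝ) (ha : Measurable a) (hD : ∀ t, 0 < t → |a t| ≤ D)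
    (G : ℂ → ℂ) (hGc : ContinuousOn G {z | 0 ≤ z.re})
    (hG : ∀ z : ℂ, 0 < z.re → ∫ t in Ioi (0:ℝ), (a t : ℂ) * Complex.exp (-z * t) = G z) :
    Tendsto (fun T : ℝ => ∫ t in Ioi (0:ℝ), a t * fejK (T - t)) atTop (𝓝 0) := by
  have hD0 : 0 ≤ D := (abs_nonneg _).trans (hD 1 one_pos)
  -- the limit identity
  have key : ∀ T : ℝ, ((∫ t in Ioi (0:ℝ), a t * fejK (T - t) : ℝ) : ℂ) =
      ∫ y in (-1:ℝ)..1, ((1 - |y| : ℝ) : ℂ) * Complex.exp (Complex.I * y * T) * G (Complex.I * y) := by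
    intro T
    have hL : Tendsto (fun ε : ℝ => ∫ t in Ioi (0:ℝ), ((a t * Real.exp (-ε * t) * fejK (T - t) : ℝ) : ℂ)) (𝓝[>] 0)
        (𝓝 (∫ t in Ioi (0:ℝ), ((a t * fejK (T - t) : ℝ) : ℂ))) := by
      apply tendsto_integral_filter_of_dominated_convergence (fun t => D * fejK (T - t))
      · filter_upwards with ε
        apply Measurable.aestronglyMeasurable
        have := fejK_continuous.measurable
        fun_prop
      · filter_upwards [self_mem_nhdsWithin] with ε hε
        filter_upwards [ae_restrict_mem measurableSet_Ioi] with t ht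
        rw [Complex.norm_real, Real.norm_eq_abs, abs_mul, abs_mul, Real.abs_exp, abs_of_nonneg (fejK_nonneg _)]
        have h1 : Real.exp (-ε * t) ≤ 1 := by
          rw [Real.exp_le_one_iff]
          have : 0 ≤ ε * t := mul_nonneg (le_of_lt hε) (le_of_lt ht)
          linarith
        have h2 := hD t ht
        have := fejK_nonneg (T - t)
        gcongr
        nlinarith [abs_nonneg (a t), Real.exp_pos (-ε * t)]
      · exact ((fejK_integrable.comp_sub_left T).const_mul D).integrableOn
      · filter_upwards with t
        have h0 : Tendsto (fun ε : ℝ => ((a t * Real.exp (-ε * t) * fejK (T - t) : ℝ) : ℂ)) (𝓝 0)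
            (𝓝 ((a t * Real.exp (-0 * t) * fejK (T - t) : ℝ) : ℂ)) := by
          apply Continuous.tendsto (f := fun ε : ℝ => ((a t * Real.exp (-ε * t) * fejK (T - t) : ℝ) : ℂ))
          fun_prop
        simp only [neg_zero, zero_mul, Real.exp_zero, mul_one] at h0
        exact h0.mono_left nhdsWithin_le_nhds
    have hcomp : IsCompact ((fun p : ℝ × ℝ => (p.1 + Complex.I * p.2 : ℂ)) '' (Icc 0 1 ×ˢ Icc (-1) 1)) := by
      apply (isCompact_Icc.prod isCompact_Icc).image
      fun_prop
    obtain ⟨Bd, hBd⟩ := hcomp.exists_bound_of_continuousOn (hGc.mono (by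
      rintro _ ⟨p, ⟨hp1, hp2⟩, rfl⟩
      simpa using hp1.1))
    have hR : Tendsto (fun ε : ℝ => ∫ y in (-1:ℝ)..1, ((1 - |y| : ℝ) : ℂ) * Complex.exp (Complex.I * y * T) * G (ε + Complex.I * y)) (𝓝[>] 0)
        (𝓝 (∫ y in (-1:ℝ)..1, ((1 - |y| : ℝ) : ℂ) * Complex.exp (Complex.I * y * T) * G (Complex.I * y))) := by
      apply intervalIntegral.tendsto_integral_filter_of_dominated_convergence (fun _ => Bd)
      · filter_upwards [self_mem_nhdsWithin] with ε hε
        apply Continuous.aestronglyMeasurable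
        apply Continuous.mul (by fun_prop)
        apply hGc.comp_continuous (by fun_prop)
        intro y
        simpa using le_of_lt hε
      · have : Ioc (0:ℝ) 1 ∈ 𝓝[>] (0:ℝ) := Ioc_mem_nhdsGT one_pos
        filter_upwards [this] with ε hε
        filter_upwards with y hy
        rw [uIoc_of_le (by norm_num)] at hy
        have h2 : |y| ≤ 1 := abs_le.2 ⟨hy.1.le, hy.2⟩
        have h3 : Complex.I * y * T = ((y * T : ℝ) : ℂ) * Complex.I := by push_cast; ring
        rw [norm_mul, norm_mul, h3, Complex.norm_exp_ofReal_mul_I, Complex.norm_real, Real.norm_eq_abs, mul_one]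
        have h4 := hBd (ε + Complex.I * y) ⟨(ε, y), ⟨⟨hε.1.le, hε.2⟩, ⟨hy.1.le, hy.2⟩⟩, rfl⟩
        have h5 : abs (1 - |y|) ≤ 1 := by
          rw [abs_of_nonneg (by linarith)]; linarith [abs_nonneg y]
        nlinarith [norm_nonneg (G (ε + Complex.I * y)), abs_nonneg (1 - |y| : ℝ)]
      · simp
      · filter_upwards with y hy
        apply Tendsto.const_mul
        have h1 : ContinuousWithinAt G {z | 0 ≤ z.re} (Complex.I * y) := hGc _ (by simp)
        apply h1.tendsto.comp
        apply tendsto_nhdsWithin_iff.2 ⟨?_, ?_⟩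
        · have : Tendsto (fun ε : ℝ => (ε + Complex.I * y : ℂ)) (𝓝 0) (𝓝 (((0:ℝ) : ℂ) + Complex.I * y)) := by
            apply Continuous.tendsto (f := fun ε : ℝ => (ε + Complex.I * y : ℂ))
            fun_prop
          simp only [Complex.ofReal_zero, zero_add] at this
          exact this.mono_left nhdsWithin_le_nhds
        · filter_upwards [self_mem_nhdsWithin] with ε hε
          simpa using le_of_lt hε
    rw [← integral_complex_ofReal]
    refine tendsto_nhds_unique hL (hR.congr' ?_)
    filter_upwards [self_mem_nhdsWithin] with ε hε
    exact (tauber_eps a D ha hD G hG T ε hε).symm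
  have RL := Real.tendsto_integral_exp_smul_cocompact
    ((Ioc (-1:ℝ) 1).indicator (fun y : ℝ => ((1 - |y| : ℝ) : ℂ) * G (Complex.I * y)))
  have hT : Tendsto (fun T : ℝ => -(T / (2 * Real.pi))) atTop (cocompact ℝ) := by
    have : Tendsto (fun T : ℝ => -(T / (2 * Real.pi))) atTop atBot :=
      tendsto_neg_atTop_atBot.comp (tendsto_id.atTop_div_const (by positivity))
    exact this.mono_right atBot_le_cocompact
  have h2 := RL.comp hT
  have h3 : Tendsto (fun T : ℝ => ((∫ t in Ioi (0:ℝ), a t * fejK (T - t) : ℝ) : ℂ)) atTop (𝓝 0) := by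
    refine h2.congr fun T => ?_
    rw [key, intervalIntegral.integral_of_le (by norm_num), ← integral_indicator measurableSet_Ioc]
    simp only [Function.comp]
    congr 1; ext y
    by_cases hy : y ∈ Ioc (-1:ℝ) 1
    · rw [indicator_of_mem hy, indicator_of_mem hy, Circle.smul_def, Real.fourierChar_apply, smul_eq_mul]
      have : (2 * Real.pi * -(y * -(T / (2 * Real.pi))) : ℝ) = y * T := by
        field_simp
      rw [this]
      push_cast
      rw [show (y : ℂ) * T * Complex.I = Complex.I * y * T by ring]
      ring
    · rw [indicator_of_notMem hy, indicator_of_notMem hy, smul_zero]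
  have := (Complex.continuous_re.tendsto 0).comp h3
  simpa [Function.comp_def] using this
end Part1

section Part2
open Filter Topology MeasureTheory Set

lemma fejK_tail : Tendsto (fun T : ℝ => ∫ t in Ioi (0:ℝ), fejK (T - t)) atTop (𝓝 (∫ u, fejK u)) := by
  have h : ∀ T : ℝ, ∫ t in Ioi (0:ℝ), fejK (T - t) = ∫ u in Iic T, fejK u := by
    intro T
    rw [integral_Iic_eq_integral_Iio, ← integral_indicator measurableSet_Ioi, ← integral_indicator measurableSet_Iio,
      ← integral_sub_left_eq_self _ volume T]
    congr 1; ext t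
    by_cases ht : t < T
    · rw [indicator_of_mem (by simpa using ht), indicator_of_mem (by simpa using ht), sub_sub_cancel]
    · rw [indicator_of_notMem (by simpa using ht), indicator_of_notMem (by simpa using ht)]
  simp_rw [h]
  have := (aecover_Iic (μ := (volume : Measure ℝ)) (tendsto_id (α := ℝ) (x := atTop))).integral_tendsto_of_countably_generated fejK_integrable
  exact this

lemma fejK_window : Tendsto (fun H : ℝ => ∫ u in Ioc (-H) H, fejK u) atTop (𝓝 (∫ u, fejK u)) :=
  (aecover_Ioc (μ := (volume : Measure ℝ)) tendsto_neg_atTop_atBot (tendsto_id (α := ℝ) (x := atTop))).integral_tendsto_of_countably_generated fejK_integrable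

lemma fejK_window_shift (T H : ℝ) : ∫ t in Ioc (T - H) (T + H), fejK (T - t) = ∫ u in Ioc (-H) H, fejK u := by
  rw [integral_Ioc_eq_integral_Ioo, integral_Ioc_eq_integral_Ioo, ← integral_indicator measurableSet_Ioo, ← integral_indicator measurableSet_Ioo,
      ← integral_sub_left_eq_self _ volume T]
  congr 1; ext t
  by_cases ht : t ∈ Ioo (-H) H
  · rw [indicator_of_mem ht, indicator_of_mem (by constructor <;> linarith [ht.1, ht.2]), sub_sub_cancel]
  · rw [indicator_of_notMem ht, indicator_of_notMem (by rintro ⟨h1, h2⟩; exact ht ⟨by linarith, by linarith⟩)]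

theorem wiener_ikehara (B : ℝ → ℝ) (C τ : ℝ) (hBm : Measurable B) (hB0 : ∀ t, 0 ≤ B t) (hBC : ∀ t, B t ≤ C)
    (hmono : ∀ t h, 0 ≤ h → B t * Real.exp (-h) ≤ B (t + h))
    (G : ℂ → ℂ) (hGc : ContinuousOn G {z | 0 ≤ z.re})
    (hG : ∀ z : ℂ, 0 < z.re → ∫ t in Ioi (0:ℝ), ((B t - τ : ℝ) : ℂ) * Complex.exp (-z * t) = G z) :
    Tendsto B atTop (𝓝 τ) := by
  set κ := ∫ u, fejK u with hκ
  have hκ0 : 0 < κ := fejK_integral_pos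
  have hC : 0 ≤ C := (hB0 0).trans (hBC 0)
  -- smoothed limits
  have hJ : ∀ l : ℝ, 0 < l → Tendsto (fun T : ℝ => ∫ t in Ioi (0:ℝ), B (t / l) * fejK (T - t)) atTop (𝓝 (τ * κ)) := by
    intro l hl
    have h1 := tauber_smooth (fun t => B (t / l) - τ) (C + |τ|) (by fun_prop) (by
      intro t ht
      have := abs_sub (B (t/l)) τ
      rw [abs_of_nonneg (hB0 _)] at this
      linarith [hBC (t/l)]) (fun z => l * G (l * z)) (by
        apply continuousOn_const.mul
        apply hGc.comp (by fun_prop)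
        intro z hz
        simp only [mem_ofPred_eq] at hz ⊢
        simp only [Complex.mul_re, Complex.ofReal_re, Complex.ofReal_im, zero_mul, sub_zero]
        positivity) (by
        intro z hz
        have := hG (l * z) (by simp; positivity)
        rw [← this]
        have h2 := integral_comp_mul_left_Ioi (fun t : ℝ => ((B (t / l) - τ : ℝ) : ℂ) * Complex.exp (-z * t)) 0 hl
        rw [mul_zero] at h2
        rw [show ∀ X : ℂ, (l : ℂ) * X = l • X from fun X => (Complex.real_smul).symm]
        rw [← inv_smul_eq_iff₀ hl.ne', ← h2]
        congr 1; ext t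
        rw [mul_div_cancel_left₀ _ hl.ne']
        push_cast
        congr 2; ring)
    have h2 := h1.add (fejK_tail.const_mul τ)
    rw [zero_add] at h2
    refine h2.congr fun T => ?_
    have hi : IntegrableOn (fun t => fejK (T - t)) (Ioi 0) := (fejK_integrable.comp_sub_left T).integrableOn
    rw [← integral_const_mul, ← integral_add]
    · congr 1; ext t; ring
    · apply (hi.const_mul (C + |τ|)).mono'
      · have := fejK_continuous.measurable
        apply Measurable.aestronglyMeasurable
        fun_prop
      · filter_upwards with t
        rw [norm_mul, Real.norm_eq_abs, Real.norm_eq_abs, abs_of_nonneg (fejK_nonneg _)]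
        apply mul_le_mul_of_nonneg_right _ (fejK_nonneg _)
        have := abs_sub (B (t/l)) τ
        rw [abs_of_nonneg (hB0 _)] at this
        linarith [hBC (t/l)]
    · exact hi.const_mul τ
  have hIntg : ∀ (l T : ℝ), Integrable (fun t => B (t / l) * fejK (T - t)) := by
    intro l T
    apply ((fejK_integrable.comp_sub_left T).const_mul C).mono'
    · have := fejK_continuous.measurable
      apply Measurable.aestronglyMeasurable
      fun_prop
    · filter_upwards with t
      rw [norm_mul, Real.norm_eq_abs, Real.norm_eq_abs, abs_of_nonneg (fejK_nonneg _), abs_of_nonneg (hB0 _)]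
      exact mul_le_mul_of_nonneg_right (hBC _) (fejK_nonneg _)
  set κH : ℝ → ℝ := fun H => ∫ u in Ioc (-H) H, fejK u with hκH
  have hκHlim : Tendsto κH atTop (𝓝 κ) := fejK_window
  -- upper
  have hup : ∀ l H T : ℝ, 0 < l → 0 < H → 0 ≤ T →
      B (T / l) * Real.exp (-(2 * H / l)) * κH H ≤ ∫ t in Ioi (0:ℝ), B (t / l) * fejK (T + H - t) := by
    intro l H T hl hH hT
    calc _ = ∫ t in Ioc (T + H - H) (T + H + H), B (T / l) * Real.exp (-(2 * H / l)) * fejK (T + H - t) := by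
          rw [integral_const_mul, fejK_window_shift]
      _ ≤ ∫ t in Ioc (T + H - H) (T + H + H), B (t / l) * fejK (T + H - t) := by
          apply setIntegral_mono_on _ (hIntg _ _).integrableOn measurableSet_Ioc
          · intro t ht
            apply mul_le_mul_of_nonneg_right _ (fejK_nonneg _)
            have h1 := hmono (T / l) ((t - T) / l) (div_nonneg (by linarith [ht.1]) hl.le)
            rw [← add_div, add_sub_cancel] at h1
            refine le_trans (mul_le_mul_of_nonneg_left ?_ (hB0 _)) h1
            apply Real.exp_le_exp.2
            apply neg_le_neg
            gcongr
            linarith [ht.2]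
          · exact ((fejK_integrable.comp_sub_left (T + H)).const_mul _).integrableOn
      _ ≤ _ := by
          apply setIntegral_mono_set (hIntg _ _).integrableOn
          · filter_upwards with t
            exact mul_nonneg (hB0 _) (fejK_nonneg _)
          · apply LE.le.eventuallyLE
            intro t ht
            simp only [mem_Ioi]
            linarith [ht.1]
  have hlow : ∀ l H T : ℝ, 0 < l → 0 < H →
      ∫ t in Ioi (0:ℝ), B (t / l) * fejK (T - H - t) ≤ B (T / l) * Real.exp (2 * H / l) * κH H + C * (κ - κH H) := by
    intro l H T hl hH
    have hs : MeasurableSet (Ioc (T - H - H) (T - H + H)) := measurableSet_Ioc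
    calc _ ≤ ∫ t, B (t / l) * fejK (T - H - t) := by
          apply setIntegral_le_integral (hIntg _ _)
          filter_upwards with t
          exact mul_nonneg (hB0 _) (fejK_nonneg _)
      _ = (∫ t in Ioc (T - H - H) (T - H + H), B (t / l) * fejK (T - H - t)) + ∫ t in (Ioc (T - H - H) (T - H + H))ᶜ, B (t / l) * fejK (T - H - t) :=
          (integral_add_compl hs (hIntg _ _)).symm
      _ ≤ (∫ t in Ioc (T - H - H) (T - H + H), B (T / l) * Real.exp (2 * H / l) * fejK (T - H - t)) + ∫ t in (Ioc (T - H - H) (T - H + H))ᶜ, C * fejK (T - H - t) := by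
          apply add_le_add
          · apply setIntegral_mono_on (hIntg _ _).integrableOn ((fejK_integrable.comp_sub_left (T - H)).const_mul _).integrableOn measurableSet_Ioc
            intro t ht
            apply mul_le_mul_of_nonneg_right _ (fejK_nonneg _)
            have h1 := hmono (t / l) ((T - t) / l) (div_nonneg (by linarith [ht.2]) hl.le)
            rw [← add_div, add_sub_cancel] at h1
            have h2 : Real.exp ((T - t) / l) ≤ Real.exp (2 * H / l) := by
              apply Real.exp_le_exp.2
              gcongr
              linarith [ht.1]
            calc B (t / l) = B (t / l) * Real.exp (-((T - t) / l)) * Real.exp ((T - t) / l) := by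
                  rw [mul_assoc, ← Real.exp_add]; simp
              _ ≤ _ := by
                  have := hB0 (T / l)
                  gcongr
          · apply integral_mono (hIntg _ _).integrableOn ((fejK_integrable.comp_sub_left (T - H)).const_mul _).integrableOn
            intro t
            exact mul_le_mul_of_nonneg_right (hBC _) (fejK_nonneg _)
      _ = _ := by
          rw [integral_const_mul, integral_const_mul, fejK_window_shift, setIntegral_compl hs (fejK_integrable.comp_sub_left (T - H)),
            fejK_window_shift, integral_sub_left_eq_self (fun u => fejK u)]
  have hinv : Tendsto (fun H : ℝ => 2 / H) atTop (𝓝 0) := tendsto_const_nhds.div_atTop tendsto_id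
  have hinv1 : Tendsto (fun H : ℝ => 1 / H) atTop (𝓝 0) := tendsto_const_nhds.div_atTop tendsto_id
  have hU : Tendsto (fun H : ℝ => Real.exp (2 / H) * (τ * κ + 1 / H) / κH H) atTop (𝓝 τ) := by
    have := (((Real.continuous_exp.tendsto 0).comp hinv).mul (hinv1.const_add (τ * κ))).div hκHlim hκ0.ne'
    simpa [Function.comp_def, hκ0.ne', Pi.div_def] using this
  have hL : Tendsto (fun H : ℝ => Real.exp (-(2 / H)) * (τ * κ - 1 / H - C * (κ - κH H)) / κH H) atTop (𝓝 τ) := by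
    have h1 : Tendsto (fun H : ℝ => -(2 / H)) atTop (𝓝 0) := by simpa using hinv.neg
    have := (((Real.continuous_exp.tendsto 0).comp h1).mul ((hinv1.const_sub (τ * κ)).sub ((hκHlim.const_sub κ).const_mul C))).div hκHlim hκ0.ne'
    simpa [Function.comp_def, hκ0.ne', Pi.div_def] using this
  rw [tendsto_order]
  constructor
  · intro x hx
    obtain ⟨H, hH1, hH2, hH3⟩ := ((hL.eventually (lt_mem_nhds hx)).and ((hκHlim.eventually (lt_mem_nhds hκ0)).and (eventually_gt_atTop 0))).exists
    have hl : 0 < H ^ 2 := by positivity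
    have e : 2 * H / H ^ 2 = 2 / H := by field_simp
    have h1 : Tendsto (fun T : ℝ => H ^ 2 * T - H) atTop atTop := tendsto_atTop_add_const_right _ _ (tendsto_id.const_mul_atTop hl)
    have hpos : 0 < 1 / H := by positivity
    filter_upwards [((hJ _ hl).comp h1).eventually (lt_mem_nhds (show τ * κ - 1 / H < τ * κ by linarith))] with T hT
    have h2 := hlow (H ^ 2) H (H ^ 2 * T) hl hH3
    simp only [Function.comp] at hT
    rw [mul_div_cancel_left₀ _ hl.ne', e] at h2
    refine lt_of_lt_of_le hH1 ?_
    rw [div_le_iff₀ hH2]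
    have h3 : τ * κ - 1 / H - C * (κ - κH H) ≤ B T * Real.exp (2 / H) * κH H := by linarith
    calc _ ≤ Real.exp (-(2 / H)) * (B T * Real.exp (2 / H) * κH H) := by gcongr
      _ = B T * κH H * (Real.exp (-(2 / H)) * Real.exp (2 / H)) := by ring
      _ = _ := by rw [← Real.exp_add]; simp
  · intro x hx
    obtain ⟨H, hH1, hH2, hH3⟩ := ((hU.eventually (gt_mem_nhds hx)).and ((hκHlim.eventually (lt_mem_nhds hκ0)).and (eventually_gt_atTop 0))).exists
    have hl : 0 < H ^ 2 := by positivity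
    have e : 2 * H / H ^ 2 = 2 / H := by field_simp
    have h1 : Tendsto (fun T : ℝ => H ^ 2 * T + H) atTop atTop := tendsto_atTop_add_const_right _ _ (tendsto_id.const_mul_atTop hl)
    have hpos : 0 < 1 / H := by positivity
    filter_upwards [eventually_ge_atTop 0, ((hJ _ hl).comp h1).eventually (gt_mem_nhds (show τ * κ < τ * κ + 1 / H by linarith))] with T hT0 hT
    have h2 := hup (H ^ 2) H (H ^ 2 * T) hl hH3 (by positivity)
    simp only [Function.comp] at hT
    rw [mul_div_cancel_left₀ _ hl.ne', e] at h2
    refine lt_of_le_of_lt ?_ hH1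
    rw [le_div_iff₀ hH2]
    have h3 : B T * Real.exp (-(2 / H)) * κH H ≤ τ * κ + 1 / H := by linarith
    calc B T * κH H = B T * κH H * (Real.exp (2 / H) * Real.exp (-(2 / H))) := by rw [← Real.exp_add]; simp
      _ = Real.exp (2 / H) * (B T * Real.exp (-(2 / H)) * κH H) := by ring
      _ ≤ _ := by gcongr
end Part2

section Part3
open Filter Topology MeasureTheory Set

lemma integral_Ioi_exp (f : ℝ → ℂ) : ∫ x in Ioi (1:ℝ), f x = ∫ t in Ioi (0:ℝ), (Real.exp t : ℂ) * f (Real.exp t) := by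
  have himg : Real.exp '' Ioi 0 = Ioi 1 := by
    ext x
    simp only [mem_image, mem_Ioi]
    constructor
    · rintro ⟨t, ht, rfl⟩; exact Real.one_lt_exp_iff.2 ht
    · intro hx; exact ⟨Real.log x, Real.log_pos hx, Real.exp_log (by linarith)⟩
  rw [← himg, integral_image_eq_integral_abs_deriv_smul measurableSet_Ioi (fun x _ => (Real.hasDerivAt_exp x).hasDerivWithinAt) Real.exp_injective.injOn]
  congr 1; ext t
  rw [abs_of_pos (Real.exp_pos t), Complex.real_smul]

open ArithmeticFunction ArithmeticFunction.vonMangoldt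

noncomputable def psiAP {q : ℕ} (a : ZMod q) (x : ℝ) : ℝ := ∑ k ∈ Finset.Icc 1 ⌊x⌋₊, residueClass a k

lemma psiAP_nonneg {q : ℕ} (a : ZMod q) (x : ℝ) : 0 ≤ psiAP a x :=
  Finset.sum_nonneg fun _ _ => residueClass_nonneg a _

lemma psiAP_mono {q : ℕ} (a : ZMod q) : Monotone (psiAP a) := by
  intro x y h
  apply Finset.sum_le_sum_of_subset_of_nonneg
  · exact Finset.Icc_subset_Icc_right (Nat.floor_mono h)
  · intros; exact residueClass_nonneg a _

lemma psiAP_le {q : ℕ} (a : ZMod q) {x : ℝ} (hx : 0 ≤ x) : psiAP a x ≤ (Real.log 4 + 4) * x := by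
  refine le_trans ?_ (Chebyshev.psi_le_const_mul_self hx)
  rw [Chebyshev.psi]
  have : Finset.Icc 1 ⌊x⌋₊ = Finset.Ioc 0 ⌊x⌋₊ := rfl
  rw [psiAP, this]
  exact Finset.sum_le_sum fun _ _ => residueClass_le a _

theorem pnt_ap {q : ℕ} [NeZero q] {a : ZMod q} (ha : IsUnit a) :
    Tendsto (fun x : ℝ => psiAP a x / x) atTop (𝓝 (1 / (q.totient : ℝ))) := by
  set τ : ℝ := 1 / (q.totient : ℝ) with hτ
  set C := Real.log 4 + 4
  have key : Tendsto (fun t : ℝ => psiAP a (Real.exp t) * Real.exp (-t)) atTop (𝓝 τ) := by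
    have hmeas : Measurable (fun t : ℝ => psiAP a (Real.exp t) * Real.exp (-t)) :=
      ((psiAP_mono a).measurable.comp Real.measurable_exp).mul (by fun_prop)
    have hbd : ∀ t, psiAP a (Real.exp t) * Real.exp (-t) ≤ C := by
      intro t
      have := psiAP_le a (Real.exp_pos t).le
      rw [Real.exp_neg, ← div_eq_mul_inv, div_le_iff₀ (Real.exp_pos t)]
      exact this
    have h0 : ∀ t, 0 ≤ psiAP a (Real.exp t) * Real.exp (-t) := fun t => mul_nonneg (psiAP_nonneg a _) (Real.exp_pos _).le
    apply wiener_ikehara _ C τ hmeas h0 hbd ?_ (fun z => (LFunctionResidueClassAux a (1 + z) - τ) / (1 + z))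
    · apply ContinuousOn.div
      · apply ContinuousOn.sub _ continuousOn_const
        apply (continuousOn_LFunctionResidueClassAux a).comp (by fun_prop)
        intro z hz
        simpa using hz
      · fun_prop
      · intro z hz h
        have := congrArg Complex.re h
        simp only [mem_ofPred_eq] at hz
        simp at this
        linarith
    · intro z hz
      have hz0 : z ≠ 0 := by rintro rfl; simp at hz
      have hz1 : 1 + z ≠ 0 := by
        intro h
        have := congrArg Complex.re h
        simp at this
        linarith
      have hs : (1:ℝ) < (1 + z).re := by simpa using hz
      have hO : (fun n : ℕ => ∑ k ∈ Finset.Icc 1 n, residueClass a k) =O[atTop] fun n => (n : ℝ) ^ (1:ℝ) := by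
        apply Asymptotics.IsBigO.of_bound C
        filter_upwards with n
        have := psiAP_le a (n.cast_nonneg : (0:ℝ) ≤ n)
        simp only [psiAP, Nat.floor_natCast] at this
        rw [Real.rpow_one, Real.norm_eq_abs, Real.norm_eq_abs, abs_of_nonneg (n.cast_nonneg : (0:ℝ) ≤ n), abs_of_nonneg (Finset.sum_nonneg fun _ _ => residueClass_nonneg a _)]
        exact this
      have h1 := LSeries_eq_mul_integral_of_nonneg (residueClass a) zero_le_one hs hO (residueClass_nonneg a)
      have h2 := eqOn_LFunctionResidueClassAux ha (x := 1 + z) hs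
      simp only [add_sub_cancel_left] at h2
      rw [integral_Ioi_exp] at h1
      have h3 : ∫ t in Ioi (0:ℝ), (Real.exp t : ℂ) * ((∑ k ∈ Finset.Icc 1 ⌊Real.exp t⌋₊, (residueClass a k : ℂ)) * (Real.exp t : ℂ) ^ (-((1 + z) + 1))) =
          ∫ t in Ioi (0:ℝ), ((psiAP a (Real.exp t) * Real.exp (-t) : ℝ) : ℂ) * Complex.exp (-z * t) := by
        congr 1; ext t
        rw [Complex.cpow_def_of_ne_zero (by exact_mod_cast (Real.exp_pos t).ne'), ← Complex.ofReal_log (Real.exp_pos t).le, Real.log_exp, psiAP]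
        push_cast
        have : Complex.exp t * Complex.exp (t * -((1 + z) + 1)) = Complex.exp (-t) * Complex.exp (-z * t) := by
          rw [← Complex.exp_add, ← Complex.exp_add]; congr 1; ring
        linear_combination (∑ k ∈ Finset.Icc 1 ⌊Real.exp t⌋₊, (residueClass a k : ℂ)) * this
      rw [h3] at h1
      have hexpint : IntegrableOn (fun t : ℝ => Complex.exp (-z * t)) (Ioi 0) :=
        integrableOn_exp_mul_complex_Ioi (by simpa using hz) 0
      have h4 : ∫ t in Ioi (0:ℝ), Complex.exp (-z * t) = 1 / z := by
        rw [integral_exp_mul_complex_Ioi (by simpa using hz)]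
        simp
      calc _ = ∫ t in Ioi (0:ℝ), (((psiAP a (Real.exp t) * Real.exp (-t) : ℝ) : ℂ) * Complex.exp (-z * t) - (τ : ℂ) * Complex.exp (-z * t)) := by
            congr 1; ext t; push_cast; ring
        _ = (∫ t in Ioi (0:ℝ), ((psiAP a (Real.exp t) * Real.exp (-t) : ℝ) : ℂ) * Complex.exp (-z * t)) - ∫ t in Ioi (0:ℝ), (τ : ℂ) * Complex.exp (-z * t) := by
            apply integral_sub _ (hexpint.const_mul _)
            apply Integrable.bdd_mul (c := C) hexpint
            · exact (Complex.measurable_ofReal.comp hmeas).aestronglyMeasurable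
            · filter_upwards with t
              rw [Complex.norm_real, Real.norm_eq_abs, abs_of_nonneg (h0 t)]
              exact hbd t
        _ = _ := by
            rw [integral_const_mul, h4, h2, h1]
            rw [hτ]
            push_cast
            field_simp
            ring_nf
    · intro t h hh
      rw [mul_assoc, ← Real.exp_add, ← neg_add]
      apply mul_le_mul_of_nonneg_right _ (Real.exp_pos _).le
      apply psiAP_mono
      apply Real.exp_le_exp.2
      linarith
  refine (key.comp Real.tendsto_log_atTop).congr' ?_
  filter_upwards [eventually_gt_atTop 0] with x hx
  simp only [Function.comp]
  rw [Real.exp_neg, Real.exp_log hx, div_eq_mul_inv]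

/-- weight at primes -/
noncomputable def wP {q : ℕ} (a : ZMod q) (k : ℕ) : ℝ := if k.Prime then residueClass a k else 0

lemma wP_nonneg {q : ℕ} (a : ZMod q) (k : ℕ) : 0 ≤ wP a k := by
  unfold wP; split_ifs
  · exact residueClass_nonneg a k
  · exact le_rfl

lemma wP_le {q : ℕ} (a : ZMod q) (k : ℕ) : wP a k ≤ residueClass a k := by
  unfold wP; split_ifs
  · exact le_rfl
  · exact residueClass_nonneg a k

noncomputable def thAP {q : ℕ} (a : ZMod q) (x : ℝ) : ℝ := ∑ k ∈ Finset.Icc 1 ⌊x⌋₊, wP a k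

lemma thAP_nonneg {q : ℕ} (a : ZMod q) (x : ℝ) : 0 ≤ thAP a x :=
  Finset.sum_nonneg fun _ _ => wP_nonneg a _

lemma thAP_le_psiAP {q : ℕ} (a : ZMod q) (x : ℝ) : thAP a x ≤ psiAP a x :=
  Finset.sum_le_sum fun _ _ => wP_le a _

lemma psiAP_sub_thAP_le {q : ℕ} (a : ZMod q) (x : ℝ) : psiAP a x - thAP a x ≤ Chebyshev.psi x - Chebyshev.theta x := by
  rw [Chebyshev.psi_sub_theta_eq_sum_not_prime, psiAP, thAP, ← Finset.sum_sub_distrib, Finset.sum_filter]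
  apply Finset.sum_le_sum
  intro k _
  unfold wP
  by_cases hk : k.Prime
  · simp [hk]
  · simp only [hk, if_false, sub_zero, not_false_eq_true, if_true]
    exact residueClass_le a k

theorem pnt_ap_theta {q : ℕ} [NeZero q] {a : ZMod q} (ha : IsUnit a) :
    Tendsto (fun x : ℝ => thAP a x / x) atTop (𝓝 (1 / (q.totient : ℝ))) := by
  obtain ⟨C, hC⟩ := Chebyshev.psi_sub_theta_le_mul_sqrt
  have h1 : Tendsto (fun x : ℝ => C / Real.sqrt x) atTop (𝓝 0) :=
    tendsto_const_nhds.div_atTop Real.tendsto_sqrt_atTop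
  have h2 := (pnt_ap ha).sub h1
  rw [sub_zero] at h2
  refine tendsto_of_tendsto_of_tendsto_of_le_of_le' h2 (pnt_ap ha) ?_ ?_
  · filter_upwards [eventually_gt_atTop 0] with x hx
    have h3 := (psiAP_sub_thAP_le a x).trans (hC x)
    have h4 : C / Real.sqrt x = C * Real.sqrt x / x := by
      have : x = Real.sqrt x * Real.sqrt x := (Real.mul_self_sqrt hx.le).symm
      have hs : Real.sqrt x ≠ 0 := (Real.sqrt_pos.2 hx).ne'
      rw [div_eq_div_iff hs hx.ne']
      nth_rw 1 [this]; ring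
    rw [h4, ← sub_div]
    gcongr
    linarith
  · filter_upwards [eventually_gt_atTop 0] with x hx
    gcongr
    exact thAP_le_psiAP a x
end Part3

section Part4
open Filter Topology MeasureTheory Set

noncomputable def kI (c : ℕ → ℝ) (τ δ : ℝ) (h : ℝ → ℝ) : ℝ :=
  δ ^ τ * ∑' m : ℕ, c m * (m : ℝ) ^ (-δ) * h ((m : ℝ) ^ (-δ))

noncomputable def kJ (A τ : ℝ) (h : ℝ → ℝ) : ℝ :=
  A / Real.Gamma τ * ∫ v in Ioi (0 : ℝ), Real.exp (-v) * v ^ (τ - 1) * h (Real.exp (-v))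

lemma kpow_mem (m : ℕ) (hm : m ≠ 0) {δ : ℝ} (hδ : 0 < δ) :
    (m : ℝ) ^ (-δ) ∈ Icc (0 : ℝ) 1 := by
  refine ⟨by positivity, ?_⟩
  apply Real.rpow_le_one_of_one_le_of_nonpos
  · exact_mod_cast Nat.one_le_iff_ne_zero.mpr hm
  · linarith

lemma kbound {h : ℝ → ℝ} (hh : Continuous h) : ∃ B : ℝ, 0 ≤ B ∧ ∀ y ∈ Icc (0 : ℝ) 1, |h y| ≤ B := by
  obtain ⟨B, hB⟩ := isCompact_Icc.exists_bound_of_continuousOn (s := Icc (0 : ℝ) 1) hh.continuousOn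
  refine ⟨max B 0, le_max_right _ _, fun y hy => ?_⟩
  have := hB y hy
  rw [Real.norm_eq_abs] at this
  exact this.trans (le_max_left _ _)

lemma kterm_le {c : ℕ → ℝ} (hc : ∀ m, 0 ≤ c m) (hc0 : c 0 = 0) {δ : ℝ} (hδ : 0 < δ)
    {h : ℝ → ℝ} {B : ℝ} (hB : ∀ y ∈ Icc (0 : ℝ) 1, |h y| ≤ B) (m : ℕ) :
    |c m * (m : ℝ) ^ (-δ) * h ((m : ℝ) ^ (-δ))| ≤ B * (c m * (m : ℝ) ^ (-δ)) := by
  rcases eq_or_ne m 0 with rfl | hm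
  · simp [hc0]
  · rw [abs_mul, abs_of_nonneg (mul_nonneg (hc m) (by positivity)), mul_comm]
    exact mul_le_mul_of_nonneg_right (hB _ (kpow_mem m hm hδ)) (mul_nonneg (hc m) (by positivity))

lemma ksummable {c : ℕ → ℝ} (hc : ∀ m, 0 ≤ c m) (hc0 : c 0 = 0)
    (hs : ∀ δ : ℝ, 0 < δ → Summable (fun m : ℕ => c m * (m : ℝ) ^ (-δ))) {δ : ℝ} (hδ : 0 < δ)
    {h : ℝ → ℝ} (hh : Continuous h) :
    Summable (fun m : ℕ => c m * (m : ℝ) ^ (-δ) * h ((m : ℝ) ^ (-δ))) := by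
  obtain ⟨B, _, hB⟩ := kbound hh
  exact Summable.of_norm_bounded ((hs δ hδ).mul_left B) (fun m => by
    rw [Real.norm_eq_abs]; exact kterm_le hc hc0 hδ hB m)

lemma kexp_mem {v : ℝ} (hv : v ∈ Ioi (0 : ℝ)) : Real.exp (-v) ∈ Icc (0 : ℝ) 1 :=
  ⟨(Real.exp_pos _).le, Real.exp_le_one_iff.mpr (by have : 0 < v := hv; linarith)⟩

lemma kJterm_le {τ : ℝ} {h : ℝ → ℝ} {B : ℝ} (hB : ∀ y ∈ Icc (0 : ℝ) 1, |h y| ≤ B)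
    {v : ℝ} (hv : v ∈ Ioi (0 : ℝ)) :
    |Real.exp (-v) * v ^ (τ - 1) * h (Real.exp (-v))| ≤ B * (Real.exp (-v) * v ^ (τ - 1)) := by
  have hv0 : 0 < v := hv
  have : 0 ≤ Real.exp (-v) * v ^ (τ - 1) := by positivity
  rw [abs_mul, abs_of_nonneg this, mul_comm]
  exact mul_le_mul_of_nonneg_right (hB _ (kexp_mem hv)) this

lemma kintegrable {τ : ℝ} (hτ : 0 < τ) {h : ℝ → ℝ} (hh : Continuous h) :
    IntegrableOn (fun v => Real.exp (-v) * v ^ (τ - 1) * h (Real.exp (-v))) (Ioi 0) := by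
  obtain ⟨B, _, hB⟩ := kbound hh
  refine Integrable.mono' ((Real.GammaIntegral_convergent hτ).const_mul B) ?_ ?_
  · have := hh.measurable
    exact Measurable.aestronglyMeasurable (by fun_prop)
  · exact (ae_restrict_mem measurableSet_Ioi).mono fun v hv => by
      rw [Real.norm_eq_abs]; exact kJterm_le hB hv

lemma kI_monomial {c : ℕ → ℝ} (hc0 : c 0 = 0)
    {τ A : ℝ} (hτ : 0 < τ)
    (hF : Tendsto (fun δ : ℝ => δ ^ τ * ∑' m : ℕ, c m * (m : ℝ) ^ (-δ)) (𝓝[>] 0) (𝓝 A)) (k : ℕ) :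
    Tendsto (fun δ => kI c τ δ (fun y => y ^ k)) (𝓝[>] 0) (𝓝 (kJ A τ (fun y => y ^ k))) := by
  have hk : (0 : ℝ) < k + 1 := by positivity
  have e1 : kJ A τ (fun y => y ^ k) = A * (1 / ((k : ℝ) + 1)) ^ τ := by
    have := Real.integral_rpow_mul_exp_neg_mul_Ioi hτ hk
    unfold kJ
    have e2 : ∫ v in Ioi (0 : ℝ), Real.exp (-v) * v ^ (τ - 1) * (Real.exp (-v)) ^ k
        = ∫ t in Ioi (0:ℝ), t ^ (τ - 1) * Real.exp (-((k + 1) * t)) := by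
      congr 1; ext v
      rw [← Real.exp_nat_mul, mul_comm (Real.exp (-v)), mul_assoc, ← Real.exp_add]
      congr 2; ring
    rw [e2, this]
    have := (Real.Gamma_pos_of_pos hτ).ne'
    field_simp
  rw [e1]
  have hl : Tendsto (fun δ : ℝ => ((k : ℝ) + 1) * δ) (𝓝[>] 0) (𝓝[>] 0) := by
    refine tendsto_nhdsWithin_iff.mpr ⟨?_, ?_⟩
    · have : Tendsto (fun δ : ℝ => ((k : ℝ) + 1) * δ) (𝓝 0) (𝓝 (((k : ℝ) + 1) * 0)) :=
        tendsto_id.const_mul _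
      rw [mul_zero] at this
      exact this.mono_left nhdsWithin_le_nhds
    · filter_upwards [self_mem_nhdsWithin] with δ hδ
      exact mul_pos hk hδ
  refine ((hF.comp hl).mul_const ((1 / ((k : ℝ) + 1)) ^ τ)).congr' ?_
  filter_upwards [self_mem_nhdsWithin] with δ hδ
  have hδ : 0 < δ := hδ
  simp only [Function.comp, kI]
  have : ∀ m : ℕ, c m * (m : ℝ) ^ (-δ) * ((m : ℝ) ^ (-δ)) ^ k = c m * (m : ℝ) ^ (-(((k : ℝ) + 1) * δ)) := by
    intro m
    rcases eq_or_ne m 0 with rfl | hm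
    · simp [hc0]
    have hm : (0 : ℝ) < m := by exact_mod_cast Nat.pos_of_ne_zero hm
    rw [mul_assoc, ← Real.rpow_natCast, ← Real.rpow_mul hm.le, ← Real.rpow_add hm]
    congr 2; ring
  simp_rw [this]
  rw [mul_right_comm, ← Real.mul_rpow (by positivity) (by positivity)]
  congr 2
  field_simp

lemma kI_add {c : ℕ → ℝ} (hc : ∀ m, 0 ≤ c m) (hc0 : c 0 = 0)
    (hs : ∀ δ : ℝ, 0 < δ → Summable (fun m : ℕ => c m * (m : ℝ) ^ (-δ))) {τ δ : ℝ} (hδ : 0 < δ)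
    {g h : ℝ → ℝ} (hg : Continuous g) (hh : Continuous h) :
    kI c τ δ (fun y => g y + h y) = kI c τ δ g + kI c τ δ h := by
  unfold kI
  rw [← mul_add, ← (ksummable hc hc0 hs hδ hg).tsum_add (ksummable hc hc0 hs hδ hh)]
  simp_rw [mul_add]

lemma kJ_add {A τ : ℝ} (hτ : 0 < τ) {g h : ℝ → ℝ} (hg : Continuous g) (hh : Continuous h) :
    kJ A τ (fun y => g y + h y) = kJ A τ g + kJ A τ h := by
  unfold kJ
  rw [← mul_add, ← integral_add (kintegrable hτ hg) (kintegrable hτ hh)]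
  simp_rw [mul_add]

lemma kI_smul (c : ℕ → ℝ) (τ δ a : ℝ) (h : ℝ → ℝ) :
    kI c τ δ (fun y => a * h y) = a * kI c τ δ h := by
  unfold kI
  rw [mul_left_comm]
  congr 1; rw [← tsum_mul_left]; refine tsum_congr fun m => ?_; ring

lemma kJ_smul (A τ a : ℝ) (h : ℝ → ℝ) :
    kJ A τ (fun y => a * h y) = a * kJ A τ h := by
  unfold kJ
  rw [mul_left_comm]
  congr 1; rw [← integral_const_mul]; refine integral_congr_ae (Eventually.of_forall fun m => ?_); dsimp only; ring

lemma kI_poly {c : ℕ → ℝ} (hc : ∀ m, 0 ≤ c m) (hc0 : c 0 = 0)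
    (hs : ∀ δ : ℝ, 0 < δ → Summable (fun m : ℕ => c m * (m : ℝ) ^ (-δ)))
    {τ A : ℝ} (hτ : 0 < τ)
    (hF : Tendsto (fun δ : ℝ => δ ^ τ * ∑' m : ℕ, c m * (m : ℝ) ^ (-δ)) (𝓝[>] 0) (𝓝 A))
    (p : Polynomial ℝ) :
    Tendsto (fun δ => kI c τ δ (fun y => p.eval y)) (𝓝[>] 0) (𝓝 (kJ A τ (fun y => p.eval y))) := by
  induction p using Polynomial.induction_on' with
  | add p q hp hq =>
    simp_rw [Polynomial.eval_add]
    rw [kJ_add hτ p.continuous q.continuous]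
    refine (hp.add hq).congr' ?_
    filter_upwards [self_mem_nhdsWithin] with δ hδ
    rw [kI_add hc hc0 hs hδ p.continuous q.continuous]
  | monomial k a =>
    simp_rw [Polynomial.eval_monomial]
    rw [kJ_smul]
    simp_rw [kI_smul]
    exact (kI_monomial hc0 hτ hF k).const_mul a

lemma kI_cont {c : ℕ → ℝ} (hc : ∀ m, 0 ≤ c m) (hc0 : c 0 = 0)
    (hs : ∀ δ : ℝ, 0 < δ → Summable (fun m : ℕ => c m * (m : ℝ) ^ (-δ)))
    {τ A : ℝ} (hτ : 0 < τ) (hA : 0 < A)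
    (hF : Tendsto (fun δ : ℝ => δ ^ τ * ∑' m : ℕ, c m * (m : ℝ) ^ (-δ)) (𝓝[>] 0) (𝓝 A))
    {h : ℝ → ℝ} (hh : Continuous h) :
    Tendsto (fun δ => kI c τ δ h) (𝓝[>] 0) (𝓝 (kJ A τ h)) := by
  have key : ∀ ε : ℝ, 0 < ε → ∃ p : Polynomial ℝ,
      (∀ δ : ℝ, 0 < δ → |kI c τ δ h - kI c τ δ (fun y => p.eval y)| ≤
        ε * (δ ^ τ * ∑' m : ℕ, c m * (m : ℝ) ^ (-δ))) ∧
      |kJ A τ h - kJ A τ (fun y => p.eval y)| ≤ ε * A := by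
    intro ε hε
    obtain ⟨p, hp⟩ := exists_polynomial_near_of_continuousOn 0 1 h hh.continuousOn ε hε
    have hB : ∀ y ∈ Icc (0:ℝ) 1, |h y - p.eval y| ≤ ε := fun y hy => by
      rw [abs_sub_comm]; exact (hp y hy).le
    refine ⟨p, fun δ hδ => ?_, ?_⟩
    · have s1 := ksummable hc hc0 hs hδ hh
      have s2 := ksummable hc hc0 hs hδ p.continuous
      unfold kI
      rw [← mul_sub, ← s1.tsum_sub s2, abs_mul, abs_of_nonneg (by positivity : 0 ≤ δ ^ τ),
        mul_left_comm]
      refine mul_le_mul_of_nonneg_left ?_ (by positivity)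
      rw [← tsum_mul_left]
      simp_rw [← mul_sub]
      have hb : ∀ m : ℕ, ‖c m * (m : ℝ) ^ (-δ) * (h ((m : ℝ) ^ (-δ)) - p.eval ((m : ℝ) ^ (-δ)))‖ ≤
          ε * (c m * (m : ℝ) ^ (-δ)) := kterm_le hc hc0 hδ (h := fun y => h y - p.eval y) hB
      have := tsum_of_norm_bounded ((hs δ hδ).mul_left ε).hasSum hb
      simpa using this
    · unfold kJ
      have hG := Real.Gamma_pos_of_pos hτ
      rw [← mul_sub, ← integral_sub (kintegrable hτ hh) (kintegrable hτ p.continuous), abs_mul,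
        abs_of_pos (by positivity)]
      simp_rw [← mul_sub]
      have : |∫ v in Ioi (0:ℝ), Real.exp (-v) * v ^ (τ - 1) * (h (Real.exp (-v)) - p.eval (Real.exp (-v)))|
          ≤ ∫ v in Ioi (0:ℝ), ε * (Real.exp (-v) * v ^ (τ - 1)) := by
        rw [← Real.norm_eq_abs]
        refine norm_integral_le_of_norm_le ((Real.GammaIntegral_convergent hτ).const_mul ε) ?_
        exact (ae_restrict_mem measurableSet_Ioi).mono fun v hv => by
          rw [Real.norm_eq_abs]; exact kJterm_le (h := fun y => h y - p.eval y) hB hv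
      rw [integral_const_mul, ← Real.Gamma_eq_integral hτ] at this
      calc _ ≤ A / Real.Gamma τ * (ε * Real.Gamma τ) := by gcongr
        _ = ε * A := by field_simp
  rw [Metric.tendsto_nhds]
  intro ε hε
  obtain ⟨p, hp1, hp2⟩ := key (ε / (4 * (A + 1))) (by positivity)
  have h1 := Metric.tendsto_nhds.mp (kI_poly hc hc0 hs hτ hF p) (ε / 4) (by positivity)
  have h2 := hF.eventually (gt_mem_nhds (by linarith : A < A + 1))
  filter_upwards [h1, h2, self_mem_nhdsWithin] with δ h1 h2 hδ
  have h3 := hp1 δ hδ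
  rw [Real.dist_eq] at *
  have h4 : ε / (4 * (A + 1)) * (δ ^ τ * ∑' m : ℕ, c m * (m : ℝ) ^ (-δ)) ≤ ε / 4 := by
    calc _ ≤ ε / (4 * (A + 1)) * (A + 1) := by gcongr
      _ = ε / 4 := by field_simp
  have h5 : ε / (4 * (A + 1)) * A ≤ ε / 4 := by
    calc _ ≤ ε / (4 * (A + 1)) * (A + 1) := by gcongr; linarith
      _ = ε / 4 := by field_simp
  rw [abs_le] at h3 hp2
  rw [abs_lt] at *
  constructor <;> linarith [h1.1, h1.2, h3.1, h3.2, hp2.1, hp2.2]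

noncomputable def kG (s t y : ℝ) : ℝ :=
  max 0 (min 1 ((y - Real.exp (-t)) / (Real.exp (-s) - Real.exp (-t)))) / max y (Real.exp (-3))

lemma kG_cont (s t : ℝ) : Continuous (kG s t) := by
  unfold kG
  refine Continuous.div (by fun_prop) (by fun_prop) fun y => ?_
  exact ((Real.exp_pos _).trans_le (le_max_right _ _)).ne'

lemma kG_nonneg (s t y : ℝ) : 0 ≤ kG s t y :=
  div_nonneg (le_max_left _ _) ((Real.exp_pos _).le.trans (le_max_right _ _))

lemma kG_zero {s t y : ℝ} (hst : s < t) (hy : y ≤ Real.exp (-t)) : kG s t y = 0 := by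
  have : (y - Real.exp (-t)) / (Real.exp (-s) - Real.exp (-t)) ≤ 0 := by
    apply div_nonpos_of_nonpos_of_nonneg
    · linarith
    · have := Real.exp_lt_exp.mpr (by linarith : -t < -s); linarith
  unfold kG
  rw [max_eq_left ((min_le_right _ _).trans this), zero_div]

lemma kG_mul_le {s t y : ℝ} (hy : 0 < y) : y * kG s t y ≤ 1 := by
  unfold kG
  have h3 : 0 < max y (Real.exp (-3)) := hy.trans_le (le_max_left _ _)
  rw [← mul_div_assoc, div_le_one h3]
  have : max 0 (min 1 ((y - Real.exp (-t)) / (Real.exp (-s) - Real.exp (-t)))) ≤ 1 :=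
    max_le zero_le_one (min_le_left _ _)
  calc _ ≤ y * 1 := by gcongr
    _ ≤ _ := by rw [mul_one]; exact le_max_left _ _

lemma kG_eq {s t y : ℝ} (hst : s < t) (hs3 : s ≤ 3) (hy : Real.exp (-s) ≤ y) : kG s t y = y⁻¹ := by
  have h0 := Real.exp_lt_exp.mpr (by linarith : -t < -s)
  have : 1 ≤ (y - Real.exp (-t)) / (Real.exp (-s) - Real.exp (-t)) := by
    rw [le_div_iff₀ (by linarith)]; linarith
  unfold kG
  rw [min_eq_left this, max_eq_right zero_le_one, max_eq_left, one_div]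
  exact (Real.exp_le_exp.mpr (by linarith)).trans hy

lemma kJ_G_bounds {A τ s t : ℝ} (hτ : 0 < τ) (hA : 0 < A) (hs : 0 ≤ s) (hst : s < t) (hs3 : s ≤ 3) :
    A / Real.Gamma τ / τ * s ^ τ ≤ kJ A τ (kG s t) ∧
    kJ A τ (kG s t) ≤ A / Real.Gamma τ / τ * t ^ τ := by
  have hG := Real.Gamma_pos_of_pos hτ
  have hI : ∀ u : ℝ, 0 ≤ u → ∫ v in Ioi (0:ℝ), (Ioc 0 u).indicator (fun v => v ^ (τ - 1)) v = u ^ τ / τ := by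
    intro u hu
    rw [integral_indicator measurableSet_Ioc, Measure.restrict_restrict measurableSet_Ioc,
      inter_eq_left.mpr Ioc_subset_Ioi_self, ← intervalIntegral.integral_of_le hu,
      integral_rpow (Or.inl (by linarith))]
    rw [sub_add_cancel, Real.zero_rpow hτ.ne', sub_zero]
  have hInt : ∀ u : ℝ, 0 ≤ u → IntegrableOn ((Ioc 0 u).indicator (fun v : ℝ => v ^ (τ - 1))) (Ioi 0) := by
    intro u hu
    apply Integrable.integrableOn
    rw [integrable_indicator_iff measurableSet_Ioc, ← intervalIntegrable_iff_integrableOn_Ioc_of_le hu]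
    exact intervalIntegral.intervalIntegrable_rpow' (by linarith)
  have hAG : 0 ≤ A / Real.Gamma τ := by positivity
  constructor
  · rw [div_mul_eq_mul_div, mul_div_assoc, ← hI s hs]
    unfold kJ
    refine mul_le_mul_of_nonneg_left ?_ hAG
    refine setIntegral_mono_on (hInt s hs) (kintegrable hτ (kG_cont s t)) measurableSet_Ioi ?_
    intro v hv
    have hv0 : 0 < v := hv
    by_cases hvs : v ≤ s
    · rw [indicator_of_mem (show v ∈ Ioc 0 s from ⟨hv0, hvs⟩),
        kG_eq hst hs3 (Real.exp_le_exp.mpr (by linarith))]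
      rw [mul_right_comm, mul_inv_cancel₀ (Real.exp_pos _).ne', one_mul]
    · rw [indicator_of_notMem (fun h => hvs h.2)]
      have := kG_nonneg s t (Real.exp (-v))
      positivity
  · have ht : 0 ≤ t := by linarith
    rw [div_mul_eq_mul_div, mul_div_assoc, ← hI t ht]
    unfold kJ
    refine mul_le_mul_of_nonneg_left ?_ hAG
    refine setIntegral_mono_on (kintegrable hτ (kG_cont s t)) (hInt t ht) measurableSet_Ioi ?_
    intro v hv
    have hv0 : 0 < v := hv
    by_cases hvs : v ≤ t
    · rw [indicator_of_mem (show v ∈ Ioc 0 t from ⟨hv0, hvs⟩), mul_right_comm]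
      have := kG_mul_le (s := s) (t := t) (Real.exp_pos (-v))
      have h2 : 0 ≤ v ^ (τ - 1) := by positivity
      nlinarith
    · rw [indicator_of_notMem (fun h => hvs h.2), kG_zero hst (Real.exp_le_exp.mpr (by linarith)), mul_zero]

/-- Karamata Tauberian theorem. -/
theorem karamata {c : ℕ → ℝ} (hc : ∀ m, 0 ≤ c m) (hc0 : c 0 = 0)
    (hs : ∀ δ : ℝ, 0 < δ → Summable (fun m : ℕ => c m * (m : ℝ) ^ (-δ)))
    {τ A : ℝ} (hτ : 0 < τ) (hA : 0 < A)
    (hF : Tendsto (fun δ : ℝ => δ ^ τ * ∑' m : ℕ, c m * (m : ℝ) ^ (-δ)) (𝓝[>] 0) (𝓝 A)) :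
    ∃ C : ℝ, 0 < C ∧ Tendsto (fun x : ℝ => (∑ m ∈ Finset.Icc 1 ⌊x⌋₊, c m) / (Real.log x) ^ τ)
      atTop (𝓝 C) := by
  have hG := Real.Gamma_pos_of_pos hτ
  set C := A / Real.Gamma τ / τ with hC
  have hC0 : 0 < C := by positivity
  have hδ : Tendsto (fun x : ℝ => (Real.log x)⁻¹) atTop (𝓝[>] 0) :=
    tendsto_inv_atTop_nhdsGT_zero.comp Real.tendsto_log_atTop
  -- comparison
  have hcmp : ∀ s t x : ℝ, 0 ≤ s → s < t → s ≤ 3 → 1 < x →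
      (t ≤ 1 → kI c τ (Real.log x)⁻¹ (kG s t) ≤ (∑ m ∈ Finset.Icc 1 ⌊x⌋₊, c m) / (Real.log x) ^ τ) ∧
      (1 ≤ s → (∑ m ∈ Finset.Icc 1 ⌊x⌋₊, c m) / (Real.log x) ^ τ ≤ kI c τ (Real.log x)⁻¹ (kG s t)) := by
    intro s t x hs0 hst hs3 hx
    have hl : 0 < Real.log x := Real.log_pos hx
    have hd : 0 < (Real.log x)⁻¹ := inv_pos.mpr hl
    have hsum := ksummable hc hc0 hs hd (kG_cont s t)
    have e0 : ∀ S : ℝ, S / (Real.log x) ^ τ = ((Real.log x)⁻¹) ^ τ * S := fun S => by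
      rw [Real.inv_rpow hl.le, div_eq_inv_mul]
    have epow : ∀ m : ℕ, m ≠ 0 → (m : ℝ) ^ (-(Real.log x)⁻¹) = Real.exp (-(Real.log m / Real.log x)) := by
      intro m hm
      rw [Real.rpow_def_of_pos (by exact_mod_cast Nat.pos_of_ne_zero hm)]
      congr 1; rw [div_eq_mul_inv]; ring
    have hmem : ∀ m : ℕ, m ≠ 0 → (m ∈ Finset.Icc 1 ⌊x⌋₊ ↔ Real.log m / Real.log x ≤ 1) := by
      intro m hm
      have hm0 : (0 : ℝ) < m := by exact_mod_cast Nat.pos_of_ne_zero hm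
      rw [Finset.mem_Icc, Nat.le_floor_iff (by linarith), div_le_one hl,
        Real.log_le_log_iff hm0 (by linarith)]
      exact ⟨fun h => h.2, fun h => ⟨Nat.one_le_iff_ne_zero.mpr hm, h⟩⟩
    rw [e0]
    unfold kI
    have hpos : (0:ℝ) ≤ ((Real.log x)⁻¹) ^ τ := by positivity
    refine ⟨fun ht => mul_le_mul_of_nonneg_left ?_ hpos, fun h1s => mul_le_mul_of_nonneg_left ?_ hpos⟩
    · rw [tsum_eq_sum (s := Finset.Icc 1 ⌊x⌋₊)]
      · refine Finset.sum_le_sum fun m hm => ?_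
        have hm0 : m ≠ 0 := by have := (Finset.mem_Icc.mp hm).1; omega
        have hm1 : (0 : ℝ) < m := by exact_mod_cast Nat.pos_of_ne_zero hm0
        rw [mul_assoc]
        exact mul_le_of_le_one_right (hc m) (kG_mul_le (by positivity))
      · intro m hm
        rcases eq_or_ne m 0 with rfl | hm0
        · simp [hc0]
        rw [hmem m hm0, not_le] at hm
        rw [epow m hm0, kG_zero hst (Real.exp_le_exp.mpr (by linarith)), mul_zero]
    · refine le_trans (le_of_eq ?_) (hsum.sum_le_tsum (Finset.Icc 1 ⌊x⌋₊) ?_)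
      · refine Finset.sum_congr rfl fun m hm => ?_
        have hm0 : m ≠ 0 := by have := (Finset.mem_Icc.mp hm).1; omega
        rw [hmem m hm0] at hm
        rw [epow m hm0, kG_eq hst hs3 (Real.exp_le_exp.mpr (by linarith)), mul_assoc,
          mul_inv_cancel₀ (Real.exp_pos _).ne', mul_one]
      · intro m _
        exact mul_nonneg (mul_nonneg (hc m) (by positivity)) (kG_nonneg _ _ _)
  refine ⟨C, hC0, ?_⟩
  have hcont : Tendsto (fun u : ℝ => C * u ^ τ) (𝓝 1) (𝓝 C) := by
    have : ContinuousAt (fun u : ℝ => C * u ^ τ) 1 :=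
      continuousAt_const.mul (Real.continuousAt_rpow_const 1 τ (Or.inl one_ne_zero))
    simpa [ContinuousAt] using this
  rw [tendsto_order]
  constructor
  · intro a ha
    have h1 := (hcont.mono_left (nhdsWithin_le_nhds (s := Iio 1))).eventually (lt_mem_nhds ha)
    have h2 : ∀ᶠ u : ℝ in 𝓝[<] 1, 0 < u := (lt_mem_nhds one_pos).filter_mono nhdsWithin_le_nhds
    obtain ⟨s, ⟨hs1, hs2⟩, hs3⟩ := ((h1.and h2).and self_mem_nhdsWithin).exists
    have hs3 : s < 1 := hs3
    have hlim := (kI_cont hc hc0 hs hτ hA hF (kG_cont s 1)).comp hδ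
    have hlt := lt_of_lt_of_le hs1 (kJ_G_bounds hτ hA hs2.le hs3 (by linarith)).1
    filter_upwards [hlim.eventually (lt_mem_nhds hlt), eventually_gt_atTop 1] with x hx hx1
    exact lt_of_lt_of_le hx ((hcmp s 1 x hs2.le hs3 (by linarith) hx1).1 le_rfl)
  · intro a ha
    have h1 := (hcont.mono_left (nhdsWithin_le_nhds (s := Ioi 1))).eventually (gt_mem_nhds ha)
    obtain ⟨t, ht1, ht2⟩ := (h1.and self_mem_nhdsWithin).exists
    have ht2 : 1 < t := ht2
    have hlim := (kI_cont hc hc0 hs hτ hA hF (kG_cont 1 t)).comp hδ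
    have hlt := lt_of_le_of_lt (kJ_G_bounds hτ hA zero_le_one ht2 (by linarith)).2 ht1
    filter_upwards [hlim.eventually (gt_mem_nhds hlt), eventually_gt_atTop 1] with x hx hx1
    exact lt_of_le_of_lt ((hcmp 1 t x zero_le_one ht2 (by linarith) hx1).2 le_rfl) hx
end Part4

section Part5
open Filter Topology MeasureTheory Set
open ArithmeticFunction ArithmeticFunction.vonMangoldt

/-- the set of admissible integers -/
def okA {q : ℕ} (a : ZMod q) (n : ℕ) : Prop :=
  Squarefree n ∧ ∀ p : ℕ, p.Prime → p ∣ n → (p : ZMod q) = a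

open Classical in
noncomputable def fA {q : ℕ} (a : ZMod q) (n : ℕ) : ℝ := if okA a n then 1 else 0

lemma fA_nonneg {q : ℕ} (a : ZMod q) (n : ℕ) : 0 ≤ fA a n := by
  unfold fA; split_ifs <;> norm_num

lemma fA_le {q : ℕ} (a : ZMod q) (n : ℕ) : fA a n ≤ 1 := by
  unfold fA; split_ifs <;> norm_num

lemma fA_zero {q : ℕ} (a : ZMod q) : fA a 0 = 0 := by
  unfold fA
  rw [if_neg]
  exact fun h => not_squarefree_zero h.1

lemma fA_one {q : ℕ} (a : ZMod q) : fA a 1 = 1 := by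
  unfold fA
  rw [if_pos]
  refine ⟨squarefree_one, fun p hp h => ?_⟩
  exact absurd (Nat.dvd_one.mp h) hp.one_lt.ne'

lemma okA.dvd {q : ℕ} {a : ZMod q} {n m : ℕ} (h : okA a n) (hm : m ∣ n) : okA a m :=
  ⟨h.1.squarefree_of_dvd hm, fun p hp hpm => h.2 p hp (hpm.trans hm)⟩

lemma wP_of {q : ℕ} {a : ZMod q} {p : ℕ} (hp : p.Prime) (ha : (p : ZMod q) = a) : wP a p = Real.log p := by
  unfold wP residueClass
  rw [if_pos hp, indicator_of_mem (show p ∈ {n : ℕ | (n : ZMod q) = a} from ha), vonMangoldt_apply_prime hp]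

lemma wP_ne {q : ℕ} {a : ZMod q} {p : ℕ} (h : wP a p ≠ 0) : p.Prime ∧ (p : ZMod q) = a := by
  unfold wP residueClass at h
  split_ifs at h with hp
  · refine ⟨hp, ?_⟩
    by_contra hne
    exact h (indicator_of_notMem (s := {n : ℕ | (n : ZMod q) = a}) hne _)
  · exact absurd rfl h

lemma wP_le_vm {q : ℕ} (a : ZMod q) (k : ℕ) : wP a k ≤ vonMangoldt k :=
  (wP_le a k).trans (residueClass_le a k)

noncomputable def w2 {q : ℕ} (a : ZMod q) (k : ℕ) : ℝ := if IsSquare k then wP a (Nat.sqrt k) else 0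

lemma w2_sq {q : ℕ} (a : ZMod q) (d : ℕ) : w2 a (d * d) = wP a d := by
  unfold w2
  rw [if_pos ⟨d, rfl⟩, Nat.sqrt_eq]

lemma w2_nonneg {q : ℕ} (a : ZMod q) (k : ℕ) : 0 ≤ w2 a k := by
  unfold w2; split_ifs
  · exact wP_nonneg _ _
  · exact le_rfl

noncomputable def cv (g h : ℕ → ℝ) (n : ℕ) : ℝ := ∑ p ∈ n.divisorsAntidiagonal, g p.1 * h p.2

lemma log_eq_vm (n : ℕ) : Real.log n = ∑ p ∈ n.divisorsAntidiagonal, vonMangoldt p.2 := by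
  rw [← vonMangoldt_sum, Nat.sum_divisorsAntidiagonal' (fun _ d => vonMangoldt d)]

lemma fA_log_le {q : ℕ} (a : ZMod q) (n : ℕ) : fA a n * Real.log n ≤ cv (fA a) (wP a) n := by
  rw [log_eq_vm, Finset.mul_sum]
  refine Finset.sum_le_sum fun p hp => ?_
  obtain ⟨hpn, hn⟩ := Nat.mem_divisorsAntidiagonal.mp hp
  by_cases h : okA a n
  · have h1 : okA a p.1 := h.dvd ⟨p.2, hpn.symm⟩
    have h2 : okA a p.2 := h.dvd ⟨p.1, by rw [← hpn, mul_comm]⟩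
    unfold fA
    rw [if_pos h, if_pos h1, one_mul, one_mul]
    by_cases hv : vonMangoldt p.2 = 0
    · rw [hv]; exact wP_nonneg _ _
    · have hpp := vonMangoldt_ne_zero_iff.mp hv
      have hpr : p.2.Prime := by
        rw [← Nat.squarefree_and_prime_pow_iff_prime]
        exact ⟨h2.1, hpp⟩
      rw [wP_of hpr (h2.2 _ hpr dvd_rfl), vonMangoldt_apply_prime hpr]
  · unfold fA
    rw [if_neg h, zero_mul]
    exact mul_nonneg (fA_nonneg a _) (wP_nonneg _ _)

lemma fA_term_le {q : ℕ} (a : ZMod q) (m d : ℕ) :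
    fA a m * wP a d ≤ fA a (m * d) * vonMangoldt d + if d ∣ m then fA a (m / d) * wP a d else 0 := by
  have hnn : 0 ≤ fA a (m * d) * vonMangoldt d := mul_nonneg (fA_nonneg a _) vonMangoldt_nonneg
  by_cases hw : wP a d = 0
  · simp only [hw, mul_zero, ite_self, add_zero]; exact hnn
  obtain ⟨hd, hda⟩ := wP_ne hw
  by_cases hm : okA a m
  · by_cases hdm : d ∣ m
    · rw [if_pos hdm]
      have : okA a (m / d) := hm.dvd (Nat.div_dvd_of_dvd hdm)
      have e1 : fA a m = 1 := if_pos hm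
      have e2 : fA a (m / d) = 1 := if_pos this
      rw [e1, e2]; linarith
    · rw [if_neg hdm, add_zero]
      have hc : Nat.Coprime m d := ((Nat.Prime.coprime_iff_not_dvd hd).mpr hdm).symm
      have : okA a (m * d) := by
        refine ⟨(Nat.squarefree_mul hc).mpr ⟨hm.1, hd.squarefree⟩, fun p hp hpd => ?_⟩
        rcases (hp.dvd_mul).mp hpd with h | h
        · exact hm.2 p hp h
        · rw [(Nat.prime_dvd_prime_iff_eq hp hd).mp h]; exact hda
      have e1 : fA a m = 1 := if_pos hm
      have e2 : fA a (m * d) = 1 := if_pos this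
      rw [e1, e2, one_mul, one_mul]
      exact wP_le_vm a d
  · have e1 : fA a m = 0 := if_neg hm
    rw [e1, zero_mul]
    refine add_nonneg hnn ?_
    split_ifs
    · exact mul_nonneg (fA_nonneg a _) (wP_nonneg _ _)
    · exact le_rfl

lemma cv_le {q : ℕ} (a : ZMod q) (n : ℕ) :
    cv (fA a) (wP a) n ≤ fA a n * Real.log n + cv (fA a) (w2 a) n := by
  have h1 : cv (fA a) (wP a) n ≤ ∑ p ∈ n.divisorsAntidiagonal, (fA a n * vonMangoldt p.2 +
      if p.2 ∣ p.1 then fA a (p.1 / p.2) * wP a p.2 else 0) := by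
    refine Finset.sum_le_sum fun p hp => ?_
    obtain ⟨hpn, hn⟩ := Nat.mem_divisorsAntidiagonal.mp hp
    have := fA_term_le a p.1 p.2
    rwa [hpn] at this
  refine h1.trans ?_
  rw [Finset.sum_add_distrib, ← Finset.mul_sum, ← log_eq_vm, ← Finset.sum_filter]
  refine add_le_add le_rfl ?_
  set S := n.divisorsAntidiagonal.filter (fun p => p.2 ∣ p.1) with hS
  have hinj : Set.InjOn (fun p : ℕ × ℕ => (p.1 / p.2, p.2 * p.2)) S := by
    rintro ⟨m, d⟩ h1 ⟨m', d'⟩ h2 h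
    simp only [Prod.mk.injEq] at h
    obtain ⟨ha, hb⟩ := h
    have hdd : d = d' := Nat.mul_self_inj.mp hb
    subst hdd
    simp only [hS, Finset.coe_filter, Set.mem_ofPred_eq, Nat.mem_divisorsAntidiagonal] at h1 h2
    rw [Nat.div_left_inj h1.2 h2.2] at ha
    rw [ha]
  have : ∑ p ∈ S, fA a (p.1 / p.2) * wP a p.2 =
      ∑ r ∈ S.image (fun p : ℕ × ℕ => (p.1 / p.2, p.2 * p.2)), fA a r.1 * w2 a r.2 := by
    rw [Finset.sum_image hinj]
    simp only [w2_sq]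
  rw [this]
  refine Finset.sum_le_sum_of_subset_of_nonneg ?_ fun r _ _ => mul_nonneg (fA_nonneg _ _) (w2_nonneg _ _)
  intro r hr
  obtain ⟨⟨m, d⟩, hp, rfl⟩ := Finset.mem_image.mp hr
  simp only [hS, Finset.mem_filter, Nat.mem_divisorsAntidiagonal] at hp ⊢
  refine ⟨?_, hp.1.2⟩
  rw [← mul_assoc, Nat.div_mul_cancel hp.2, hp.1.1]

lemma summable_w2 {q : ℕ} (a : ZMod q) : Summable (fun k : ℕ => w2 a k * (k : ℝ) ^ (-1 : ℝ)) := by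
  have hinj : Function.Injective (fun d : ℕ => d * d) := fun x y h => Nat.mul_self_inj.mp h
  rw [← hinj.summable_iff]
  · have hs : Summable (fun d : ℕ => 2 * (d : ℝ) ^ (-(3/2) : ℝ)) :=
      (Real.summable_nat_rpow.mpr (by norm_num)).mul_left 2
    refine Summable.of_nonneg_of_le (fun d => ?_) (fun d => ?_) hs
    · exact mul_nonneg (w2_nonneg _ _) (by positivity)
    · simp only [Function.comp, w2_sq]
      rcases Nat.eq_zero_or_pos d with rfl | hd
      · rw [show wP a 0 = 0 by simp [wP, Nat.not_prime_zero]]; simp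
      have hd : (0 : ℝ) < d := by exact_mod_cast hd
      have h1 : wP a d ≤ (d : ℝ) ^ (1/2 : ℝ) / (1/2) :=
        ((wP_le_vm a d).trans vonMangoldt_le_log).trans (Real.log_le_rpow_div hd.le one_half_pos)
      calc wP a d * ((d * d : ℕ) : ℝ) ^ (-1 : ℝ) ≤ (d : ℝ) ^ (1/2 : ℝ) / (1/2) * ((d * d : ℕ) : ℝ) ^ (-1 : ℝ) := by
            gcongr
        _ = 2 * (d : ℝ) ^ (-(3/2) : ℝ) := by
            push_cast
            rw [Real.mul_rpow hd.le hd.le, ← Real.rpow_add hd, div_mul_eq_mul_div, ← Real.rpow_add hd]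
            norm_num
            ring
  · intro k hk
    unfold w2
    rw [if_neg, zero_mul]
    rintro ⟨d, rfl⟩
    exact hk ⟨d, rfl⟩
end Part5

section Part6
open Filter Topology MeasureTheory Set
open ArithmeticFunction ArithmeticFunction.vonMangoldt

noncomputable def DS (g : ℕ → ℝ) (s : ℝ) : ℝ := ∑' n : ℕ, g n * (n : ℝ) ^ (-s)
def SS (g : ℕ → ℝ) (s : ℝ) : Prop := Summable (fun n : ℕ => g n * (n : ℝ) ^ (-s))

lemma term_real {g : ℕ → ℝ} (hg : g 0 = 0) (s : ℝ) (n : ℕ) :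
    LSeries.term (fun n => (g n : ℂ)) s n = ((g n * (n : ℝ) ^ (-s) : ℝ) : ℂ) := by
  rcases eq_or_ne n 0 with rfl | hn
  · simp [hg]
  · rw [LSeries.term_of_ne_zero hn, ← Complex.ofReal_natCast n, ← Complex.ofReal_cpow n.cast_nonneg,
      ← Complex.ofReal_div, Real.rpow_neg n.cast_nonneg, div_eq_mul_inv]

lemma SS_iff {g : ℕ → ℝ} (hg : g 0 = 0) (s : ℝ) :
    LSeriesSummable (fun n => (g n : ℂ)) s ↔ SS g s := by
  unfold LSeriesSummable SS
  rw [funext (term_real hg s), Complex.summable_ofReal]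

lemma DS_eq {g : ℕ → ℝ} (hg : g 0 = 0) (s : ℝ) :
    LSeries (fun n => (g n : ℂ)) s = (DS g s : ℂ) := by
  unfold LSeries DS
  rw [funext (term_real hg s), Complex.ofReal_tsum]

lemma cv_zero (g h : ℕ → ℝ) : cv g h 0 = 0 := by simp [cv]

lemma cv_conv (g h : ℕ → ℝ) : LSeries.convolution (fun n => (g n : ℂ)) (fun n => (h n : ℂ)) =
    fun n => (cv g h n : ℂ) := by
  rw [LSeries.convolution_def]
  ext n
  simp [cv]

lemma SS_cv {g h : ℕ → ℝ} (hg : g 0 = 0) (hh : h 0 = 0) {s : ℝ} (sg : SS g s) (sh : SS h s) :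
    SS (cv g h) s := by
  rw [← SS_iff (cv_zero g h), ← cv_conv]
  exact LSeriesSummable.convolution ((SS_iff hg s).mpr sg) ((SS_iff hh s).mpr sh)

lemma DS_cv {g h : ℕ → ℝ} (hg : g 0 = 0) (hh : h 0 = 0) {s : ℝ} (sg : SS g s) (sh : SS h s) :
    DS (cv g h) s = DS g s * DS h s := by
  have := LSeries_convolution' ((SS_iff hg s).mpr sg) ((SS_iff hh s).mpr sh)
  rw [cv_conv, DS_eq (cv_zero g h), DS_eq hg, DS_eq hh] at this
  exact_mod_cast this

lemma absc_fA {q : ℕ} (a : ZMod q) : LSeries.abscissaOfAbsConv (fun n => (fA a n : ℂ)) ≤ 1 := by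
  refine LSeries.abscissaOfAbsConv_le_of_le_const ⟨1, fun n _ => ?_⟩
  rw [Complex.norm_real, Real.norm_eq_abs, abs_of_nonneg (fA_nonneg a n)]
  exact fA_le a n

lemma SS_fA {q : ℕ} (a : ZMod q) {s : ℝ} (hs : 1 < s) : SS (fA a) s := by
  rw [← SS_iff (fA_zero a)]
  apply LSeriesSummable_of_abscissaOfAbsConv_lt_re
  exact (absc_fA a).trans_lt (by rw [Complex.ofReal_re]; exact_mod_cast hs)

noncomputable def fL {q : ℕ} (a : ZMod q) (n : ℕ) : ℝ := fA a n * Real.log n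

lemma fL_zero {q : ℕ} (a : ZMod q) : fL a 0 = 0 := by simp [fL]

lemma logMul_fA {q : ℕ} (a : ZMod q) : LSeries.logMul (fun n => (fA a n : ℂ)) = fun n => (fL a n : ℂ) := by
  ext n
  unfold LSeries.logMul fL
  push_cast
  rw [mul_comm]

lemma DS_fA_deriv {q : ℕ} (a : ZMod q) {s : ℝ} (hs : 1 < s) :
    HasDerivAt (DS (fA a)) (-DS (fL a) s) s := by
  have h : LSeries.abscissaOfAbsConv (fun n => (fA a n : ℂ)) < (s : ℂ).re :=
    (absc_fA a).trans_lt (by rw [Complex.ofReal_re]; exact_mod_cast hs)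
  have := (LSeries_hasDerivAt h).real_of_complex
  rw [logMul_fA, DS_eq (fL_zero a)] at this
  simpa [DS_eq (fA_zero a)] using this

lemma SS_rc {q : ℕ} (a : ZMod q) {s : ℝ} (hs : 1 < s) : SS (residueClass a) s := by
  rw [← SS_iff (residueClass_apply_zero a)]
  apply LSeriesSummable_of_abscissaOfAbsConv_lt_re
  exact (abscissaOfAbsConv_residueClass_le_one a).trans_lt (by rw [Complex.ofReal_re]; exact_mod_cast hs)

lemma SS_mono {g h : ℕ → ℝ} {s : ℝ} (hg : ∀ n, 0 ≤ g n) (hgh : ∀ n, g n ≤ h n) (sh : SS h s) : SS g s :=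
  Summable.of_nonneg_of_le (fun n => mul_nonneg (hg n) (by positivity))
    (fun n => mul_le_mul_of_nonneg_right (hgh n) (by positivity)) sh

lemma DS_mono {g h : ℕ → ℝ} {s : ℝ} (hg : ∀ n, 0 ≤ g n) (hgh : ∀ n, g n ≤ h n) (sh : SS h s) : DS g s ≤ DS h s :=
  Summable.tsum_le_tsum (fun n => mul_le_mul_of_nonneg_right (hgh n) (by positivity)) (SS_mono hg hgh sh) sh

lemma SS_of_one {g : ℕ → ℝ} (hg0 : g 0 = 0) {s : ℝ} (hg : ∀ n, 0 ≤ g n) (h1 : SS g 1) (hs : 1 ≤ s) :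
    SS g s ∧ DS g s ≤ DS g 1 := by
  have hle : ∀ n : ℕ, g n * (n : ℝ) ^ (-s) ≤ g n * (n : ℝ) ^ (-1 : ℝ) := by
    intro n
    rcases eq_or_ne n 0 with rfl | hn
    · simp [hg0]
    · refine mul_le_mul_of_nonneg_left ?_ (hg n)
      exact Real.rpow_le_rpow_of_exponent_le (by exact_mod_cast Nat.one_le_iff_ne_zero.mpr hn) (by linarith)
  have : SS g s := Summable.of_nonneg_of_le (fun n => mul_nonneg (hg n) (by positivity)) hle h1
  exact ⟨this, Summable.tsum_le_tsum hle this h1⟩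

lemma wP_zero {q : ℕ} (a : ZMod q) : wP a 0 = 0 := by simp [wP, Nat.not_prime_zero]
lemma w2_zero {q : ℕ} (a : ZMod q) : w2 a 0 = 0 := by simpa [wP_zero] using w2_sq a 0

lemma SS_wP {q : ℕ} (a : ZMod q) {s : ℝ} (hs : 1 < s) : SS (wP a) s :=
  SS_mono (wP_nonneg a) (wP_le a) (SS_rc a hs)

lemma DS_wP_bound {q : ℕ} [NeZero q] {a : ZMod q} (ha : IsUnit a) :
    ∃ K : ℝ, ∀ s : ℝ, s ∈ Ioc (1 : ℝ) 2 → |DS (wP a) s - (1 / (q.totient : ℝ)) / (s - 1)| ≤ K := by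
  have hcont : ContinuousOn (fun x : ℝ ↦ LFunctionResidueClassAux a x) (Icc 1 2) :=
    (continuousOn_LFunctionResidueClassAux a).comp Complex.continuous_ofReal.continuousOn fun x hx ↦ by
        simpa only [Set.mem_ofPred_eq, Complex.ofReal_re] using hx.1
  obtain ⟨B, hB⟩ := isCompact_Icc.exists_bound_of_continuousOn hcont
  let g : ℕ → ℝ := fun n => if n.Prime then 0 else residueClass a n
  have hg0 : ∀ n, 0 ≤ g n := fun n => by
    simp only [g]; split_ifs
    · exact le_rfl
    · exact residueClass_nonneg a n
  have hgz : g 0 = 0 := by simp [g]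
  have hg1 : SS g 1 := by
    have := summable_residueClass_non_primes_div a
    refine this.congr fun n => ?_
    rw [Real.rpow_neg_one, div_eq_mul_inv]
  refine ⟨B + DS g 1, fun s hs => ?_⟩
  obtain ⟨sg, dg⟩ := SS_of_one hgz hg0 hg1 hs.1.le
  have hsplit : DS (residueClass a) s = DS g s + DS (wP a) s := by
    unfold DS
    rw [← Summable.tsum_add sg (SS_wP a hs.1)]
    refine tsum_congr fun n => ?_
    simp only [g, wP]
    split_ifs <;> ring
  have hdg : 0 ≤ DS g s := tsum_nonneg fun n => mul_nonneg (hg0 n) (by positivity)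
  have h1 := eqOn_LFunctionResidueClassAux ha (x := (s : ℂ)) (by simpa using hs.1)
  simp only at h1
  rw [DS_eq (residueClass_apply_zero a)] at h1
  have h2 := hB s ⟨hs.1.le, hs.2⟩
  rw [h1] at h2
  have h3 : ((DS (residueClass a) s : ℂ) - (q.totient : ℂ)⁻¹ / ((s : ℂ) - 1)) =
      ((DS (residueClass a) s - (1 / (q.totient : ℝ)) / (s - 1) : ℝ) : ℂ) := by
    push_cast; rw [one_div]
  rw [h3, Complex.norm_real, Real.norm_eq_abs, hsplit] at h2
  rw [abs_le] at h2 ⊢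
  constructor <;> linarith [h2.1, h2.2]

lemma DS_fA_pos {q : ℕ} (a : ZMod q) {s : ℝ} (hs : 1 < s) : 0 < DS (fA a) s := by
  have : (fA a 1) * ((1 : ℕ) : ℝ) ^ (-s) ≤ DS (fA a) s :=
    Summable.le_tsum (SS_fA a hs) 1 fun n _ => mul_nonneg (fA_nonneg a n) (by positivity)
  rw [fA_one] at this
  simp at this
  linarith

lemma fL_nonneg {q : ℕ} (a : ZMod q) (n : ℕ) : 0 ≤ fL a n :=
  mul_nonneg (fA_nonneg a n) (Real.log_natCast_nonneg n)

lemma cv_nonneg {g h : ℕ → ℝ} (hg : ∀ n, 0 ≤ g n) (hh : ∀ n, 0 ≤ h n) (n : ℕ) : 0 ≤ cv g h n :=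
  Finset.sum_nonneg fun _ _ => mul_nonneg (hg _) (hh _)

lemma logderiv_bound {q : ℕ} [NeZero q] {a : ZMod q} (ha : IsUnit a) :
    ∃ K : ℝ, ∀ s : ℝ, s ∈ Ioc (1 : ℝ) 2 →
      |-DS (fL a) s / DS (fA a) s + (1 / (q.totient : ℝ)) / (s - 1)| ≤ K := by
  obtain ⟨K, hK⟩ := DS_wP_bound ha
  have h2 : SS (w2 a) 1 := summable_w2 a
  refine ⟨K + DS (w2 a) 1, fun s hs => ?_⟩
  obtain ⟨s2, d2⟩ := SS_of_one (w2_zero a) (w2_nonneg a) h2 hs.1.le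
  have d20 : 0 ≤ DS (w2 a) s := tsum_nonneg fun n => mul_nonneg (w2_nonneg a n) (by positivity)
  have sf := SS_fA a hs.1
  have sw := SS_wP a hs.1
  have scv := SS_cv (fA_zero a) (wP_zero a) sf sw
  have scv2 := SS_cv (fA_zero a) (w2_zero a) sf s2
  have sL : SS (fL a) s := SS_mono (fL_nonneg a) (fA_log_le a) scv
  have up : DS (fL a) s ≤ DS (fA a) s * DS (wP a) s := by
    rw [← DS_cv (fA_zero a) (wP_zero a) sf sw]
    exact DS_mono (fL_nonneg a) (fA_log_le a) scv
  have lo : DS (fA a) s * DS (wP a) s ≤ DS (fL a) s + DS (fA a) s * DS (w2 a) s := by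
    rw [← DS_cv (fA_zero a) (wP_zero a) sf sw, ← DS_cv (fA_zero a) (w2_zero a) sf s2]
    unfold DS
    rw [← Summable.tsum_add sL scv2]
    refine Summable.tsum_le_tsum (fun n => ?_) scv (Summable.add sL scv2)
    rw [← add_mul]
    exact mul_le_mul_of_nonneg_right (cv_le a n) (by positivity)
  have hF := DS_fA_pos a hs.1
  have u1 : DS (fL a) s / DS (fA a) s ≤ DS (wP a) s := by rw [div_le_iff₀ hF]; linarith
  have u2 : DS (wP a) s - DS (w2 a) s ≤ DS (fL a) s / DS (fA a) s := by
    rw [le_div_iff₀ hF]; linarith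
  have h3 := hK s hs
  rw [neg_div]
  rw [abs_le] at h3 ⊢
  constructor <;> linarith [h3.1, h3.2]

/-- a function with bounded derivative on `(0,1]` has a limit at `0+`. -/
lemma limit_of_bounded_deriv {g g' : ℝ → ℝ} {K : ℝ} (h : ∀ x ∈ Ioc (0 : ℝ) 1, HasDerivAt g (g' x) x)
    (hK : ∀ x ∈ Ioc (0 : ℝ) 1, |g' x| ≤ K) : ∃ L, Tendsto g (𝓝[>] 0) (𝓝 L) := by
  have hL : ∀ x ∈ Ioc (0 : ℝ) 1, ∀ y ∈ Ioc (0 : ℝ) 1, ‖g y - g x‖ ≤ K * ‖y - x‖ := fun x hx y hy =>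
    Convex.norm_image_sub_le_of_norm_hasDerivWithin_le (fun z hz => (h z hz).hasDerivWithinAt)
      (fun z hz => by rw [Real.norm_eq_abs]; exact hK z hz) (convex_Ioc 0 1) hx hy
  have hl : LipschitzOnWith (Real.toNNReal K) g (Ioc 0 1) := by
    apply LipschitzOnWith.of_dist_le_mul
    intro x hx y hy
    rw [dist_eq_norm, dist_eq_norm]
    refine (hL y hy x hx).trans ?_
    gcongr
    exact Real.le_coe_toNNReal K
  have hc : Cauchy (map g (𝓝[>] 0)) := by
    have hb : Cauchy (𝓝[>] (0:ℝ)) := cauchy_nhds.mono nhdsWithin_le_nhds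
    refine hb.map_of_le hl.uniformContinuousOn ?_
    rw [le_principal_iff]
    exact Ioc_mem_nhdsGT one_pos
  exact cauchy_map_iff_exists_tendsto.mp hc

lemma F_asymp {q : ℕ} [NeZero q] {a : ZMod q} (ha : IsUnit a) :
    ∃ A : ℝ, 0 < A ∧ Tendsto (fun δ : ℝ => δ ^ (1 / (q.totient : ℝ)) * DS (fA a) (1 + δ)) (𝓝[>] 0) (𝓝 A) := by
  obtain ⟨K, hK⟩ := logderiv_bound ha
  set τ := 1 / (q.totient : ℝ) with hτ
  obtain ⟨L, hL⟩ := limit_of_bounded_deriv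
    (g := fun δ => Real.log (DS (fA a) (1 + δ)) + τ * Real.log δ)
    (g' := fun δ => -DS (fL a) (1 + δ) / DS (fA a) (1 + δ) + τ / (1 + δ - 1)) (K := K)
    (fun x hx => by
      have h1 : HasDerivAt (fun δ : ℝ => DS (fA a) (1 + δ)) (-DS (fL a) (1 + x)) x :=
        (DS_fA_deriv a (by linarith [hx.1] : 1 < 1 + x)).comp_const_add 1 x
      have h2 := h1.log (DS_fA_pos a (by linarith [hx.1])).ne'
      have h3 := (Real.hasDerivAt_log hx.1.ne').const_mul τ
      have h4 := h2.add h3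
      have e : -DS (fL a) (1 + x) / DS (fA a) (1 + x) + τ / (1 + x - 1) =
          -DS (fL a) (1 + x) / DS (fA a) (1 + x) + τ * x⁻¹ := by
        rw [add_sub_cancel_left, div_eq_mul_inv τ]
      rw [e]
      exact h4)
    (fun x hx => hK (1 + x) ⟨by linarith [hx.1], by linarith [hx.2]⟩)
  refine ⟨Real.exp L, Real.exp_pos L, ?_⟩
  refine ((Real.continuous_exp.tendsto L).comp hL).congr' ?_
  filter_upwards [self_mem_nhdsWithin] with δ hδ
  have hδ : 0 < δ := hδ
  simp only [Function.comp]
  rw [Real.exp_add, Real.exp_log (DS_fA_pos a (by linarith)), Real.rpow_def_of_pos hδ, mul_comm,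
    mul_comm τ]
end Part6

section Part7
open Filter Topology MeasureTheory Set
open ArithmeticFunction ArithmeticFunction.vonMangoldt

lemma sum_cv {g h : ℕ → ℝ} (hg : g 0 = 0) (hh : h 0 = 0) (N : ℕ) :
    ∑ n ∈ Finset.Icc 1 N, cv g h n = ∑ m ∈ Finset.Icc 1 N, g m * ∑ k ∈ Finset.Icc 1 (N / m), h k := by
  obtain ⟨G, hG⟩ : ∃ G : ArithmeticFunction ℝ, ∀ n, G n = g n := ⟨⟨g, hg⟩, fun _ => rfl⟩
  obtain ⟨H, hH⟩ : ∃ H : ArithmeticFunction ℝ, ∀ n, H n = h n := ⟨⟨h, hh⟩, fun _ => rfl⟩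
  have := sum_Ioc_mul_eq_sum_sum G H N
  simp only [ArithmeticFunction.mul_apply, hG, hH] at this
  exact this

lemma cv_comm (g h : ℕ → ℝ) (n : ℕ) : cv g h n = cv h g n := by
  unfold cv
  conv_lhs => rw [← Nat.map_swap_divisorsAntidiagonal, Finset.sum_map]
  refine Finset.sum_congr rfl fun p _ => ?_
  exact mul_comm _ _

noncomputable def mM {q : ℕ} (a : ZMod q) (x : ℝ) : ℝ := ∑ m ∈ Finset.Icc 1 ⌊x⌋₊, fA a m / m

lemma mM_asymp {q : ℕ} [NeZero q] {a : ZMod q} (ha : IsUnit a) :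
    ∃ C : ℝ, 0 < C ∧ Tendsto (fun x : ℝ => mM a x / (Real.log x) ^ (1 / (q.totient : ℝ))) atTop (𝓝 C) := by
  obtain ⟨A, hA, hF⟩ := F_asymp ha
  have hq : 0 < 1 / (q.totient : ℝ) := by
    have : (0 : ℝ) < q.totient := by exact_mod_cast q.totient.pos_of_neZero
    positivity
  have e : ∀ (δ : ℝ) (m : ℕ), fA a m / m * (m : ℝ) ^ (-δ) = fA a m * (m : ℝ) ^ (-(1 + δ)) := by
    intro δ m
    rcases eq_or_ne m 0 with rfl | hm
    · simp [fA_zero]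
    · have hm : (0 : ℝ) < m := by exact_mod_cast Nat.pos_of_ne_zero hm
      rw [neg_add, Real.rpow_add hm, Real.rpow_neg_one, div_eq_mul_inv, mul_assoc]
  refine karamata (c := fun m => fA a m / m) (fun m => div_nonneg (fA_nonneg a m) m.cast_nonneg) (by simp) ?_ hq hA ?_
  · intro δ hδ
    simp_rw [e]
    exact SS_fA a (by linarith)
  · simp_rw [e]
    exact hF

noncomputable def tT {q : ℕ} (a : ZMod q) (x : ℝ) : ℝ := ∑ n ∈ Finset.Icc 1 ⌊x⌋₊, cv (fA a) (wP a) n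

lemma tT_eq {q : ℕ} (a : ZMod q) (x : ℝ) : tT a x = ∑ m ∈ Finset.Icc 1 ⌊x⌋₊, fA a m * thAP a (x / m) := by
  unfold tT thAP
  rw [sum_cv (fA_zero a) (wP_zero a)]
  simp_rw [Nat.floor_div_natCast]

noncomputable def nN {q : ℕ} (a : ZMod q) (x : ℝ) : ℝ := ∑ n ∈ Finset.Icc 1 ⌊x⌋₊, fL a n

lemma nN_le {q : ℕ} (a : ZMod q) (x : ℝ) : nN a x ≤ tT a x :=
  Finset.sum_le_sum fun n _ => fA_log_le a n

lemma tT_le {q : ℕ} (a : ZMod q) {x : ℝ} (hx : 0 ≤ x) : tT a x ≤ nN a x + DS (w2 a) 1 * x := by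
  have h1 : tT a x ≤ ∑ n ∈ Finset.Icc 1 ⌊x⌋₊, (fL a n + cv (fA a) (w2 a) n) :=
    Finset.sum_le_sum fun n _ => cv_le a n
  rw [Finset.sum_add_distrib] at h1
  refine h1.trans (add_le_add le_rfl ?_)
  simp_rw [cv_comm (fA a)]
  rw [sum_cv (w2_zero a) (fA_zero a)]
  have h2 : ∑ k ∈ Finset.Icc 1 ⌊x⌋₊, w2 a k * (k : ℝ) ^ (-1 : ℝ) ≤ DS (w2 a) 1 :=
    Summable.sum_le_tsum _ (fun k _ => mul_nonneg (w2_nonneg a k) (by positivity)) (summable_w2 a)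
  refine le_trans ?_ (mul_le_mul_of_nonneg_right h2 hx)
  rw [Finset.sum_mul]
  refine Finset.sum_le_sum fun k _ => ?_
  rw [mul_assoc]
  refine mul_le_mul_of_nonneg_left ?_ (w2_nonneg a k)
  calc ∑ m ∈ Finset.Icc 1 (⌊x⌋₊ / k), fA a m ≤ ∑ m ∈ Finset.Icc 1 (⌊x⌋₊ / k), (1 : ℝ) :=
        Finset.sum_le_sum fun m _ => fA_le a m
    _ = ((⌊x⌋₊ / k : ℕ) : ℝ) := by simp
    _ = (⌊x / k⌋₊ : ℝ) := by rw [Nat.floor_div_natCast]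
    _ ≤ x / k := Nat.floor_le (by positivity)
    _ = _ := by rw [Real.rpow_neg_one, div_eq_inv_mul]

lemma tT_sub_le {q : ℕ} (a : ZMod q) {τ ε D Y : ℝ} (hε : 0 ≤ ε) (hY : 0 < Y)
    (h1 : ∀ y : ℝ, Y ≤ y → |thAP a y - τ * y| ≤ ε * y) (h2 : ∀ y : ℝ, 0 ≤ y → |thAP a y - τ * y| ≤ D * y)
    (hY1 : 1 ≤ Y) {x : ℝ} (hx : 0 ≤ x) :
    |tT a x - τ * x * mM a x| ≤ ε * x * mM a x + D * x * (mM a x - mM a (x / Y)) := by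
  have hsub : Finset.Icc 1 ⌊x / Y⌋₊ ⊆ Finset.Icc 1 ⌊x⌋₊ :=
    Finset.Icc_subset_Icc le_rfl (Nat.floor_mono (div_le_self hx hY1))
  have e1 : mM a x - mM a (x / Y) = ∑ m ∈ Finset.Icc 1 ⌊x⌋₊ \ Finset.Icc 1 ⌊x / Y⌋₊, fA a m / m := by
    unfold mM
    rw [← Finset.sum_sdiff hsub]; ring
  have e2 : mM a x - mM a (x / Y) = ∑ m ∈ Finset.Icc 1 ⌊x⌋₊,
      if m ∈ Finset.Icc 1 ⌊x / Y⌋₊ then 0 else fA a m / m := by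
    rw [e1, Finset.sdiff_eq_filter, Finset.sum_filter]
    refine Finset.sum_congr rfl fun m _ => ?_
    split_ifs <;> simp_all
  rw [e2, tT_eq, mM, Finset.mul_sum, Finset.mul_sum, Finset.mul_sum, ← Finset.sum_sub_distrib,
    ← Finset.sum_add_distrib]
  refine (Finset.abs_sum_le_sum_abs _ _).trans (Finset.sum_le_sum fun m hm => ?_)
  have hm1 := (Finset.mem_Icc.mp hm).1
  have hm0 : (0 : ℝ) < m := by exact_mod_cast hm1
  have hf := fA_nonneg a m
  have e3 : fA a m * thAP a (x / m) - τ * x * (fA a m / m) = fA a m * (thAP a (x / m) - τ * (x / m)) := by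
    field_simp
  rw [e3, abs_mul, abs_of_nonneg hf]
  split_ifs with hmY
  · have : (m : ℝ) ≤ x / Y := (Nat.le_floor_iff (by positivity)).mp (Finset.mem_Icc.mp hmY).2
    have hy : Y ≤ x / m := by
      rw [le_div_iff₀ hY] at this
      rw [le_div_iff₀ hm0]; linarith
    calc _ ≤ fA a m * (ε * (x / m)) := mul_le_mul_of_nonneg_left (h1 _ hy) hf
      _ = _ := by field_simp; ring
  · calc _ ≤ fA a m * (D * (x / m)) := mul_le_mul_of_nonneg_left (h2 _ (by positivity)) hf
      _ = D * x * (fA a m / m) := by field_simp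
      _ ≤ _ := le_add_of_nonneg_left (by positivity)

lemma tT_asymp {q : ℕ} [NeZero q] {a : ZMod q} (ha : IsUnit a) {C : ℝ} (hC : 0 < C)
    (hM : Tendsto (fun x : ℝ => mM a x / (Real.log x) ^ (1 / (q.totient : ℝ))) atTop (𝓝 C)) :
    Tendsto (fun x : ℝ => tT a x / (x * (Real.log x) ^ (1 / (q.totient : ℝ)))) atTop
      (𝓝 (1 / (q.totient : ℝ) * C)) := by
  have hth := pnt_ap_theta ha
  set τ := 1 / (q.totient : ℝ) with hτ
  have hτ0 : 0 ≤ τ := by positivity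
  set D := Real.log 4 + 4 + τ with hDdef
  have hD : 0 ≤ D := by have := Real.log_nonneg (by norm_num : (1:ℝ) ≤ 4); positivity
  have h2 : ∀ y : ℝ, 0 ≤ y → |thAP a y - τ * y| ≤ D * y := by
    intro y hy
    have h3 := thAP_nonneg a y
    have h4 := (thAP_le_psiAP a y).trans (psiAP_le a hy)
    have h5 : 0 ≤ τ * y := by positivity
    have h6 := Real.log_nonneg (by norm_num : (1:ℝ) ≤ 4)
    have h7 : 0 ≤ (Real.log 4 + 4) * y := by positivity
    rw [abs_le, hDdef, add_mul]
    constructor <;> linarith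
  have hratio : ∀ Y : ℝ, 0 < Y →
      Tendsto (fun x : ℝ => mM a (x / Y) / (Real.log x) ^ τ) atTop (𝓝 C) := by
    intro Y hY
    have t1 : Tendsto (fun x : ℝ => x / Y) atTop atTop := tendsto_id.atTop_div_const hY
    have t2 := hM.comp t1
    have t3 : Tendsto (fun x : ℝ => Real.log (x / Y) / Real.log x) atTop (𝓝 1) := by
      have : Tendsto (fun x : ℝ => 1 - Real.log Y * (Real.log x)⁻¹) atTop (𝓝 (1 - Real.log Y * 0)) :=
        (tendsto_const_nhds).sub ((tendsto_inv_atTop_zero.comp Real.tendsto_log_atTop).const_mul _)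
      rw [mul_zero, sub_zero] at this
      refine this.congr' ?_
      filter_upwards [eventually_gt_atTop 1] with x hx
      have hl := (Real.log_pos hx).ne'
      rw [Real.log_div (by linarith) hY.ne']
      field_simp
    have t4 : Tendsto (fun x : ℝ => (Real.log (x / Y) / Real.log x) ^ τ) atTop (𝓝 (1 ^ τ)) :=
      t3.rpow_const (Or.inl one_ne_zero)
    rw [Real.one_rpow] at t4
    have t5 := t2.mul t4
    rw [mul_one] at t5
    refine t5.congr' ?_
    filter_upwards [eventually_gt_atTop 1, eventually_gt_atTop Y] with x hx hxY
    have hl := Real.log_pos hx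
    have hl2 : 0 < Real.log (x / Y) := Real.log_pos (by rw [lt_div_iff₀ hY]; linarith)
    simp only [Function.comp]
    rw [Real.div_rpow hl2.le hl.le]
    have := (Real.rpow_pos_of_pos hl2 τ).ne'
    have := (Real.rpow_pos_of_pos hl τ).ne'
    field_simp
  have key : Tendsto (fun x : ℝ => tT a x / (x * (Real.log x) ^ τ) - τ * (mM a x / (Real.log x) ^ τ)) atTop (𝓝 0) := by
    rw [Metric.tendsto_nhds]
    intro ε hε
    obtain ⟨Y0, hY0⟩ := eventually_atTop.mp (Metric.tendsto_nhds.mp hth (ε / (2 * (C + 1))) (by positivity))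
    set Y := max Y0 1 with hYdef
    have hY : 0 < Y := lt_of_lt_of_le one_pos (le_max_right _ _)
    have h1 : ∀ y : ℝ, Y ≤ y → |thAP a y - τ * y| ≤ ε / (2 * (C + 1)) * y := by
      intro y hy
      have hy0 : 0 < y := hY.trans_le hy
      have := hY0 y ((le_max_left _ _).trans hy)
      rw [Real.dist_eq] at this
      have e : thAP a y - τ * y = (thAP a y / y - τ) * y := by field_simp
      rw [e, abs_mul, abs_of_pos hy0]
      exact mul_le_mul_of_nonneg_right this.le hy0.le
    have lim : Tendsto (fun x : ℝ => ε / (2 * (C + 1)) * (mM a x / (Real.log x) ^ τ) +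
        D * (mM a x / (Real.log x) ^ τ - mM a (x / Y) / (Real.log x) ^ τ)) atTop
        (𝓝 (ε / (2 * (C + 1)) * C + D * (C - C))) :=
      (hM.const_mul _).add ((hM.sub (hratio Y hY)).const_mul _)
    have hlt : ε / (2 * (C + 1)) * C + D * (C - C) < ε := by
      rw [sub_self, mul_zero, add_zero, div_mul_eq_mul_div, div_lt_iff₀ (by positivity)]
      nlinarith
    filter_upwards [lim.eventually (gt_mem_nhds hlt), eventually_gt_atTop 1] with x hx hx1
    have hb := tT_sub_le a (by positivity : 0 ≤ ε / (2 * (C + 1))) hY h1 h2 (le_max_right _ _) (by linarith : 0 ≤ x)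
    have hL := Real.rpow_pos_of_pos (Real.log_pos hx1) τ
    have hx0 : 0 < x := by linarith
    rw [dist_zero_right, Real.norm_eq_abs]
    refine lt_of_le_of_lt ?_ hx
    have e : tT a x / (x * (Real.log x) ^ τ) - τ * (mM a x / (Real.log x) ^ τ) =
        (tT a x - τ * x * mM a x) / (x * (Real.log x) ^ τ) := by
      field_simp
    rw [e, abs_div, abs_of_pos (mul_pos hx0 hL), div_le_iff₀ (mul_pos hx0 hL)]
    refine hb.trans (le_of_eq ?_)
    field_simp
  have := key.add (hM.const_mul τ)
  rw [zero_add] at this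
  simpa using this

noncomputable def sS {q : ℕ} (a : ZMod q) (x : ℝ) : ℝ := ∑ n ∈ Finset.Icc 1 ⌊x⌋₊, fA a n

lemma sum_inv_sqrt (N : ℕ) : ∑ m ∈ Finset.Icc 1 N, 1 / Real.sqrt m ≤ 2 * Real.sqrt N := by
  induction N with
  | zero => simp
  | succ N ih =>
    rw [Finset.sum_Icc_succ_top (by omega)]
    have hs : 0 < Real.sqrt ((N + 1 : ℕ) : ℝ) := Real.sqrt_pos.mpr (by positivity)
    have h1 := Real.sq_sqrt (by positivity : (0:ℝ) ≤ ((N + 1 : ℕ) : ℝ))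
    have h2 := Real.sq_sqrt (by positivity : (0:ℝ) ≤ (N : ℝ))
    have : 1 / Real.sqrt ((N + 1 : ℕ) : ℝ) ≤ 2 * Real.sqrt ((N + 1 : ℕ) : ℝ) - 2 * Real.sqrt N := by
      rw [div_le_iff₀ hs]
      push_cast at *
      nlinarith [sq_nonneg (Real.sqrt ((N : ℝ) + 1) - Real.sqrt N)]
    linarith

lemma sS_log {q : ℕ} (a : ZMod q) {x : ℝ} (hx : 1 ≤ x) :
    nN a x ≤ sS a x * Real.log x ∧ sS a x * Real.log x ≤ nN a x + 4 * x := by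
  have hx0 : 0 < x := by linarith
  have hm : ∀ m ∈ Finset.Icc 1 ⌊x⌋₊, (0 : ℝ) < m ∧ (m : ℝ) ≤ x := fun m hm =>
    ⟨by exact_mod_cast (Finset.mem_Icc.mp hm).1, (Nat.le_floor_iff hx0.le).mp (Finset.mem_Icc.mp hm).2⟩
  unfold nN sS fL
  rw [Finset.sum_mul]
  constructor
  · refine Finset.sum_le_sum fun m h => mul_le_mul_of_nonneg_left ?_ (fA_nonneg a m)
    exact Real.log_le_log (hm m h).1 (hm m h).2
  · have h4 : ∑ m ∈ Finset.Icc 1 ⌊x⌋₊, 2 * Real.sqrt x * (1 / Real.sqrt m) ≤ 4 * x := by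
      rw [← Finset.mul_sum]
      have h5 := sum_inv_sqrt ⌊x⌋₊
      have h6 : Real.sqrt (⌊x⌋₊ : ℝ) ≤ Real.sqrt x := Real.sqrt_le_sqrt (Nat.floor_le hx0.le)
      have h7 := Real.mul_self_sqrt hx0.le
      have h8 := Real.sqrt_nonneg x
      nlinarith
    refine le_trans ?_ (add_le_add le_rfl h4)
    rw [← Finset.sum_add_distrib]
    refine Finset.sum_le_sum fun m h => ?_
    obtain ⟨h0, h1⟩ := hm m h
    have hlog : Real.log x - Real.log m ≤ 2 * Real.sqrt x * (1 / Real.sqrt m) := by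
      rw [← Real.log_div hx0.ne' h0.ne']
      have := Real.log_le_rpow_div (by positivity : 0 ≤ x / m) one_half_pos
      rw [← Real.sqrt_eq_rpow, Real.sqrt_div hx0.le] at this
      calc _ ≤ _ := this
        _ = _ := by ring
    have hl0 : 0 ≤ Real.log x - Real.log m := sub_nonneg.mpr (Real.log_le_log h0 h1)
    nlinarith [fA_nonneg a m, fA_le a m]

lemma sS_asymp {q : ℕ} [NeZero q] {a : ZMod q} (ha : IsUnit a) :
    ∃ c : ℝ, 0 < c ∧ Tendsto (fun x : ℝ => sS a x / (x / (Real.log x) ^ (1 - 1 / (q.totient : ℝ)))) atTop (𝓝 c) := by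
  obtain ⟨C, hC, hM⟩ := mM_asymp ha
  have hT := tT_asymp ha hC hM
  have hq : 0 < 1 / (q.totient : ℝ) := by
    have : (0 : ℝ) < q.totient := by exact_mod_cast q.totient.pos_of_neZero
    positivity
  set τ := 1 / (q.totient : ℝ) with hτ
  refine ⟨τ * C, by positivity, ?_⟩
  set K := DS (w2 a) 1 + 4 with hK
  have hinv : Tendsto (fun x : ℝ => K * ((Real.log x) ^ τ)⁻¹) atTop (𝓝 (K * 0)) :=
    (tendsto_inv_atTop_zero.comp ((tendsto_rpow_atTop hq).comp Real.tendsto_log_atTop)).const_mul K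
  rw [mul_zero] at hinv
  have hd : Tendsto (fun x : ℝ => sS a x * Real.log x / (x * (Real.log x) ^ τ) - tT a x / (x * (Real.log x) ^ τ))
      atTop (𝓝 0) := by
    refine squeeze_zero_norm' ?_ hinv
    filter_upwards [eventually_gt_atTop 1] with x hx
    have hx0 : 0 < x := by linarith
    have hL := Real.rpow_pos_of_pos (Real.log_pos hx) τ
    obtain ⟨b1, b2⟩ := sS_log a hx.le
    have b3 := nN_le a x
    have b4 := tT_le a hx0.le
    have h2 : 0 ≤ DS (w2 a) 1 := tsum_nonneg fun n => mul_nonneg (w2_nonneg a n) (by positivity)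
    have h3 : 0 ≤ DS (w2 a) 1 * x := by positivity
    rw [← sub_div, Real.norm_eq_abs, abs_div, abs_of_pos (mul_pos hx0 hL), div_le_iff₀ (mul_pos hx0 hL)]
    have e : K * ((Real.log x) ^ τ)⁻¹ * (x * (Real.log x) ^ τ) = DS (w2 a) 1 * x + 4 * x := by
      rw [hK]; field_simp
    rw [e, abs_le]
    constructor <;> linarith
  have := hd.add hT
  rw [zero_add] at this
  refine this.congr' ?_
  filter_upwards [eventually_gt_atTop 1] with x hx
  have hx0 : 0 < x := by linarith
  have hl := Real.log_pos hx
  have hL := Real.rpow_pos_of_pos hl τ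
  rw [Real.rpow_sub hl, Real.rpow_one, sub_add_cancel]
  field_simp

open Classical in
lemma card_eq {n b : ℕ} {X : ℝ} (hX : 0 ≤ X) :
    (Nat.card {x : ℕ | 0 < x ∧ (x : ℝ) ≤ X ∧ Squarefree x ∧
              ∀ p : ℕ, p.Prime → p ∣ x → p % n = b % n} : ℝ) = sS (b : ZMod n) X := by
  have : {x : ℕ | 0 < x ∧ (x : ℝ) ≤ X ∧ Squarefree x ∧
              ∀ p : ℕ, p.Prime → p ∣ x → p % n = b % n} =
      ((Finset.Icc 1 ⌊X⌋₊).filter (fun m => okA (b : ZMod n) m) : Set ℕ) := by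
    ext x
    simp only [Set.mem_ofPred_eq, Finset.coe_filter, Finset.mem_Icc, Nat.le_floor_iff hX, okA,
      ZMod.natCast_eq_natCast_iff']
    rw [Nat.succ_le_iff, and_assoc]
  rw [this, Nat.card_coe_set_eq, Set.ncard_coe_finset]
  unfold sS fA
  rw [Finset.sum_boole]
end Part7

/-- Let `Ω(X)` be the set of squarefree positive integers `x ≤ X` all of whose
prime factors are `≡ b (mod n)`.  Then `|Ω(X)| = (c + o(1)) · X / (log X)^(1 - 1/φ(n))`
for some constant `c > 0`. -/
theorem count_squarefree_with_prime_factors_in_progression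
    (n b : ℕ) (hn : 0 < n) (hb : Nat.Coprime b n) :
    ∃ c : ℝ, 0 < c ∧
      (fun X : ℝ =>
          (Nat.card {x : ℕ | 0 < x ∧ (x : ℝ) ≤ X ∧ Squarefree x ∧
              ∀ p : ℕ, p.Prime → p ∣ x → p % n = b % n} : ℝ) -
            c * X / (Real.log X) ^ (1 - 1 / (Nat.totient n : ℝ))) =o[atTop]
        fun X : ℝ => X / (Real.log X) ^ (1 - 1 / (Nat.totient n : ℝ)) := by
  have : NeZero n := ⟨hn.ne'⟩
  obtain ⟨c, hc, h⟩ := sS_asymp (q := n) (a := (b : ZMod n)) ((ZMod.isUnit_iff_coprime b n).mpr hb)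
  refine ⟨c, hc, ?_⟩
  have hpos : ∀ᶠ X : ℝ in atTop, 0 < X / (Real.log X) ^ (1 - 1 / (Nat.totient n : ℝ)) := by
    filter_upwards [eventually_gt_atTop 1] with X hX
    have := Real.rpow_pos_of_pos (Real.log_pos hX) (1 - 1 / (Nat.totient n : ℝ))
    have : 0 < X := by linarith
    positivity
  rw [Asymptotics.isLittleO_iff_tendsto' (hpos.mono fun X hX h0 => absurd h0 hX.ne')]
  have h2 := h.sub_const c
  rw [sub_self] at h2
  refine h2.congr' ?_
  filter_upwards [hpos, eventually_gt_atTop 1] with X hX hX1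
  rw [card_eq (by linarith), mul_div_assoc, sub_div, mul_div_cancel_right₀ _ hX.ne']
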